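/- arXiv:1711.05776 — 3 statements merged into one kernel-verified Lean document; each statement's English description precedes it below -/
import Mathlib

section
/- Let k be an algebraically closed field of characteristic coprime to 6 and let C = {q = 0} be a smooth plane quartic. Then C has three non-concurrent hyperinflection lines (three distinct hyperinflection lines with no common point) if and only if there exist M ∈ GL₃(k), a nonzero scalar c ∈ k, and constants ε, λ, μ, ν ∈ k with ε⁴ = 1 such that c·q(M·(x,y,z)ᵗ) = q_ε(x,y,z) + xyz(λx + μy + νz). -/
open MvPolynomial

noncomputable section

/-- The classical invariant `S` of a binary quartic form with coefficients `f 0, …, f 4`. -/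
def Sinv {R : Type*} [CommRing R] (f : Fin 5 → R) : R :=
  12 * f 0 * f 4 - 3 * f 1 * f 3 + f 2 ^ 2

/-- The classical invariant `T` of a binary quartic form with coefficients `f 0, …, f 4`. -/
def Tinv {R : Type*} [CommRing R] (f : Fin 5 → R) : R :=
  72 * f 0 * f 2 * f 4 - 27 * f 0 * f 3 ^ 2 - 27 * f 1 ^ 2 * f 4
    + 9 * f 1 * f 2 * f 3 - 2 * f 2 ^ 3

/-- The binary quartic form `f₀ y⁴ + f₁ y³z + f₂ y²z² + f₃ yz³ + f₄ z⁴`. -/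
def binQuartic {R : Type*} [CommRing R] (f : Fin 5 → R) : MvPolynomial (Fin 2) R :=
  ∑ i : Fin 5, C (f i) * X 0 ^ (4 - (i : ℕ)) * X 1 ^ (i : ℕ)

/-- The `i`-th coefficient of a binary quartic form: coefficient of `y^(4-i) z^i`. -/
def binCoeff {R : Type*} [CommRing R] (g : MvPolynomial (Fin 2) R) (i : Fin 5) : R :=
  coeff (Finsupp.single 0 (4 - (i : ℕ)) + Finsupp.single 1 (i : ℕ)) g

/-- The substitution `g(y,z) = q(-v·y - w·z, u·y, u·z)`, a binary quartic form in `y, z` with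
coefficients in `R[u,v,w]`. -/
def gsub {R : Type*} [CommRing R] (q : MvPolynomial (Fin 3) R) :
    MvPolynomial (Fin 2) (MvPolynomial (Fin 3) R) :=
  aeval
    (![(C (- X 1) * X 0 - C (X 2) * X 1 : MvPolynomial (Fin 2) (MvPolynomial (Fin 3) R)),
       C (X 0) * X 0, C (X 0) * X 1]) q

/-- `u⁴ · H(q)`, the invariant `S` of `g(y,z) = q(-vy-wz, uy, uz)`; the harmonic quartic `H(q)`
is the form determined by `u⁴ · H(q) = SG q`. -/
def SG {R : Type*} [CommRing R] (q : MvPolynomial (Fin 3) R) : MvPolynomial (Fin 3) R :=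
  Sinv (fun i => binCoeff (gsub q) i)

/-- `u⁶ · K(q)`, the invariant `T` of `g(y,z) = q(-vy-wz, uy, uz)`; the harmonic sextic `K(q)`
is the form determined by `u⁶ · K(q) = TG q`. -/
def TG {R : Type*} [CommRing R] (q : MvPolynomial (Fin 3) R) : MvPolynomial (Fin 3) R :=
  Tinv (fun i => binCoeff (gsub q) i)

/-- dot product of two vectors in `R³`. -/
def dot3 {R : Type*} [CommRing R] (d a : Fin 3 → R) : R :=
  d 0 * a 0 + d 1 * a 1 + d 2 * a 2

/-- restriction of a ternary form to the parameterized line `(y,z) ↦ y·a + z·b`. -/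
def restrictLine {R : Type*} [CommRing R] (q : MvPolynomial (Fin 3) R) (a b : Fin 3 → R) :
    MvPolynomial (Fin 2) R :=
  aeval (fun i => C (a i) * X 0 + C (b i) * X 1) q

/-- A binary quartic form vanishes identically or has a root of multiplicity at least `3`:
`f = L³·M` with `L ≠ 0` linear and `M` linear (possibly zero). -/
def HasTripleRoot {R : Type*} [CommRing R] (f : MvPolynomial (Fin 2) R) : Prop :=
  ∃ L M : MvPolynomial (Fin 2) R,
    L.IsHomogeneous 1 ∧ M.IsHomogeneous 1 ∧ L ≠ 0 ∧ f = L ^ 3 * M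

/-- The line with dual coordinates `d` is an inflection line of the quartic `{q = 0}`. -/
def IsInflectionLine {k : Type*} [Field k] (q : MvPolynomial (Fin 3) k) (d : Fin 3 → k) :
    Prop :=
  d ≠ 0 ∧ ∃ a b : Fin 3 → k, LinearIndependent k ![a, b] ∧
    dot3 d a = 0 ∧ dot3 d b = 0 ∧ HasTripleRoot (restrictLine q a b)

/-- The line with dual coordinates `d` is a simple inflection line of `{q = 0}` with
inflection point `p`. -/
def IsSimpleInflectionLineAt {k : Type*} [Field k] (q : MvPolynomial (Fin 3) k)
    (d p : Fin 3 → k) : Prop :=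
  d ≠ 0 ∧ ∃ (a b : Fin 3 → k) (s t : k), LinearIndependent k ![a, b] ∧
    dot3 d a = 0 ∧ dot3 d b = 0 ∧ (s, t) ≠ (0, 0) ∧
    (∀ i, p i = s * a i + t * b i) ∧
    eval p q = 0 ∧ (∃ i, eval p (pderiv i q) ≠ 0) ∧
    ∃ L M : MvPolynomial (Fin 2) k, L.IsHomogeneous 1 ∧ M.IsHomogeneous 1 ∧
      LinearIndependent k ![L, M] ∧
      restrictLine q a b = L ^ 3 * M ∧ eval ![s, t] L = 0

/-- The line with dual coordinates `d` is a hyperinflection line of `{q = 0}` with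
hyperinflection point `p`. -/
def IsHyperinflectionLineAt {k : Type*} [Field k] (q : MvPolynomial (Fin 3) k)
    (d p : Fin 3 → k) : Prop :=
  d ≠ 0 ∧ ∃ (a b : Fin 3 → k) (s t : k), LinearIndependent k ![a, b] ∧
    dot3 d a = 0 ∧ dot3 d b = 0 ∧ (s, t) ≠ (0, 0) ∧
    (∀ i, p i = s * a i + t * b i) ∧
    eval p q = 0 ∧ (∃ i, eval p (pderiv i q) ≠ 0) ∧
    ∃ (c : k) (L : MvPolynomial (Fin 2) k), c ≠ 0 ∧ L.IsHomogeneous 1 ∧ L ≠ 0 ∧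
      restrictLine q a b = C c * L ^ 4 ∧ eval ![s, t] L = 0

/-- The pairing `⟨·,·⟩` between quartic forms in `x,y,z` and quartic forms in `u,v,w`:
`⟨x^i y^j z^k, u^i v^j w^k⟩ = i!j!k!/2`. -/
def pairQ {R : Type*} [CommRing R] (q h : MvPolynomial (Fin 3) R) : R :=
  ∑ m ∈ q.support,
    (((m 0).factorial * (m 1).factorial * (m 2).factorial / 2 : ℕ) : R)
      * coeff m q * coeff m h

/-- The action of `Σ c_{ξη} ξ ∂_η ∈ 𝔤𝔩₃(R)` on polynomials. -/
def lieAct {R : Type*} [CommRing R] (c : Fin 3 → Fin 3 → R)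
    (q : MvPolynomial (Fin 3) R) : MvPolynomial (Fin 3) R :=
  ∑ ξ : Fin 3, ∑ η : Fin 3, C (c ξ η) * (X ξ * pderiv η q)

/-- substitution of variables by the linear change of coordinates `M`: `q(M·(x,y,z)ᵗ)`. -/
def substM {R : Type*} [CommRing R] (M : Matrix (Fin 3) (Fin 3) R)
    (q : MvPolynomial (Fin 3) R) : MvPolynomial (Fin 3) R :=
  aeval (fun i => ∑ j : Fin 3, C (M i j) * X j) q

/-- The quartic form `q_ε = (x−y)⁴ + (x−z)⁴ + (y−εz)⁴ − (x⁴ + y⁴ + z⁴)`. -/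
def qeps {k : Type*} [CommRing k] (ε : k) : MvPolynomial (Fin 3) k :=
  (X 0 - X 1) ^ 4 + (X 0 - X 2) ^ 4 + (X 1 - C ε * X 2) ^ 4
    - (X 0 ^ 4 + X 1 ^ 4 + X 2 ^ 4)

/-- A ternary quartic with explicit coefficients. -/
def Q15 {k : Type*} [CommRing k] (a b c ab3 ab2 ab1 ac3 ac2 ac1 bc3 bc2 bc1 l m n : k) :
    MvPolynomial (Fin 3) k :=
  C a * X 0 ^ 4 + C b * X 1 ^ 4 + C c * X 2 ^ 4
  + C ab3 * X 0 ^ 3 * X 1 + C ab2 * X 0 ^ 2 * X 1 ^ 2 + C ab1 * X 0 * X 1 ^ 3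
  + C ac3 * X 0 ^ 3 * X 2 + C ac2 * X 0 ^ 2 * X 2 ^ 2 + C ac1 * X 0 * X 2 ^ 3
  + C bc3 * X 1 ^ 3 * X 2 + C bc2 * X 1 ^ 2 * X 2 ^ 2 + C bc1 * X 1 * X 2 ^ 3
  + C l * X 0 ^ 2 * X 1 * X 2 + C m * X 0 * X 1 ^ 2 * X 2 + C n * X 0 * X 1 * X 2 ^ 2

/-- A binary quartic with explicit coefficients. -/
def B5 {k : Type*} [CommRing k] (a b c d e : k) : MvPolynomial (Fin 2) k :=
  C a * X 0 ^ 4 + C b * X 0 ^ 3 * X 1 + C c * X 0 ^ 2 * X 1 ^ 2 + C d * X 0 * X 1 ^ 3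
    + C e * X 1 ^ 4

theorem homog_sum {k : Type*} [CommRing k] (r n : ℕ) (q : MvPolynomial (Fin r) k)
    (h : q.IsHomogeneous n) :
    q = ∑ t ∈ Finset.Nat.antidiagonalTuple r n,
      C (coeff (Finsupp.equivFunOnFinite.symm t) q) * ∏ i, X i ^ (t i) := by
  have h1 : ∀ t : Fin r → ℕ, C (coeff (Finsupp.equivFunOnFinite.symm t) q) *
      ∏ i, (X i : MvPolynomial (Fin r) k) ^ (t i) =
      monomial (Finsupp.equivFunOnFinite.symm t)
        (coeff (Finsupp.equivFunOnFinite.symm t) q) := by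
    intro t
    rw [monomial_eq, Finsupp.prod_fintype _ _ (by simp)]
    simp
  simp_rw [h1]
  ext m
  rw [coeff_sum]
  by_cases hm : coeff m q = 0
  · rw [hm, Finset.sum_eq_zero]
    intro t _
    rw [coeff_monomial]
    split_ifs with h2
    · rw [h2, hm]
    · rfl
  · rw [Finset.sum_eq_single (m : Fin r → ℕ)]
    · simp [coeff_monomial]
    · intro t _ ht
      rw [coeff_monomial, if_neg]
      rintro rfl
      exact ht (by simp)
    · intro h3
      exfalso
      apply h3
      rw [Finset.Nat.mem_antidiagonalTuple]
      have := h hm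
      rw [← this, Finsupp.weight_apply, Finsupp.sum_fintype _ _ (by simp)]
      simp

theorem tuple34 : Finset.Nat.antidiagonalTuple 3 4 =
    {![4,0,0],![0,4,0],![0,0,4],![3,1,0],![2,2,0],![1,3,0],![3,0,1],![2,0,2],![1,0,3],
      ![0,3,1],![0,2,2],![0,1,3],![2,1,1],![1,2,1],![1,1,2]} := by decide

theorem quartic_exp {k : Type*} [CommRing k] (q : MvPolynomial (Fin 3) k)
    (h : q.IsHomogeneous 4) :
    ∃ a b c ab3 ab2 ab1 ac3 ac2 ac1 bc3 bc2 bc1 l m n : k,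
      q = Q15 a b c ab3 ab2 ab1 ac3 ac2 ac1 bc3 bc2 bc1 l m n := by
  have h1 := homog_sum 3 4 q h
  rw [tuple34] at h1
  repeat rw [Finset.sum_insert (by decide)] at h1
  rw [Finset.sum_singleton] at h1
  let f : (Fin 3 → ℕ) → k := fun t => coeff (Finsupp.equivFunOnFinite.symm t) q
  refine ⟨f ![4,0,0], f ![0,4,0], f ![0,0,4], f ![3,1,0], f ![2,2,0], f ![1,3,0], f ![3,0,1], f ![2,0,2],
    f ![1,0,3], f ![0,3,1], f ![0,2,2], f ![0,1,3], f ![2,1,1], f ![1,2,1], f ![1,1,2], h1.trans ?_⟩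
  simp only [Fin.prod_univ_three, Q15, f]
  simp
  ring

theorem linear_exp {k : Type*} [CommRing k] (q : MvPolynomial (Fin 2) k)
    (h : q.IsHomogeneous 1) : ∃ a b : k, q = C a * X 0 + C b * X 1 := by
  have h1 := homog_sum 2 1 q h
  rw [show Finset.Nat.antidiagonalTuple 2 1 = {![1,0],![0,1]} by decide,
    Finset.sum_insert (by decide), Finset.sum_singleton] at h1
  refine ⟨coeff (Finsupp.equivFunOnFinite.symm ![1,0]) q,
    coeff (Finsupp.equivFunOnFinite.symm ![0,1]) q, h1.trans ?_⟩
  simp [Fin.prod_univ_two]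

theorem B5_eq_monomial {k : Type*} [CommRing k] (a b c d e : k) :
    B5 a b c d e = monomial (Finsupp.single 0 4 + Finsupp.single 1 0) a
      + monomial (Finsupp.single 0 3 + Finsupp.single 1 1) b
      + monomial (Finsupp.single 0 2 + Finsupp.single 1 2) c
      + monomial (Finsupp.single 0 1 + Finsupp.single 1 3) d
      + monomial (Finsupp.single 0 0 + Finsupp.single 1 4) e := by
  have h : ∀ (i j : ℕ) (x : k), monomial (Finsupp.single (0 : Fin 2) i + Finsupp.single 1 j) x
      = C x * X 0 ^ i * X 1 ^ j := by
    intro i j x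
    rw [X_pow_eq_monomial, X_pow_eq_monomial, C_mul_monomial, monomial_mul]
    simp
  simp only [h, B5]
  ring

theorem coeff_B5 {k : Type*} [CommRing k] (a b c d e : k) (i j : ℕ) :
    coeff (Finsupp.single 0 i + Finsupp.single 1 j) (B5 a b c d e) =
      (if 4 = i ∧ 0 = j then a else 0) + (if 3 = i ∧ 1 = j then b else 0)
      + (if 2 = i ∧ 2 = j then c else 0) + (if 1 = i ∧ 3 = j then d else 0)
      + (if 0 = i ∧ 4 = j then e else 0) := by
  have h : ∀ (i j i' j' : ℕ), (Finsupp.single (0 : Fin 2) i + Finsupp.single 1 j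
      = Finsupp.single (0 : Fin 2) i' + Finsupp.single 1 j') ↔ (i = i' ∧ j = j') := by
    intro i j i' j'
    constructor
    · intro h
      have h0 := DFunLike.congr_fun h 0
      have h1 := DFunLike.congr_fun h 1
      simp at h0 h1
      exact ⟨h0, h1⟩
    · rintro ⟨rfl, rfl⟩; rfl
  rw [B5_eq_monomial]
  simp only [coeff_add, coeff_monomial, h]

theorem B5_inj {k : Type*} [CommRing k] {a b c d e a' b' c' d' e' : k}
    (h : B5 a b c d e = B5 a' b' c' d' e') :
    a = a' ∧ b = b' ∧ c = c' ∧ d = d' ∧ e = e' := by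
  have key := fun i j => congrArg (coeff (Finsupp.single 0 i + Finsupp.single 1 j)) h
  simp only [coeff_B5] at key
  refine ⟨?_, ?_, ?_, ?_, ?_⟩
  · simpa using key 4 0
  · simpa using key 3 1
  · simpa using key 2 2
  · simpa using key 1 3
  · simpa using key 0 4

theorem B5_pow {k : Type*} [CommRing k] (m n : k) :
    (C m * X 0 + C n * X 1) ^ 4 =
      B5 (m ^ 4) (4 * m ^ 3 * n) (6 * m ^ 2 * n ^ 2) (4 * m * n ^ 3) (n ^ 4) := by
  simp only [B5, map_mul, map_pow, map_ofNat]
  ring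

theorem substM_mul {k : Type*} [CommRing k] (M N : Matrix (Fin 3) (Fin 3) k)
    (q : MvPolynomial (Fin 3) k) : substM (M * N) q = substM N (substM M q) := by
  unfold substM
  rw [comp_aeval_apply]
  congr 2
  funext i
  simp only [Matrix.mul_apply, Fin.sum_univ_three, map_add, map_mul, aeval_X, aeval_C,
    algebraMap_eq]
  ring

theorem restrict_substM {k : Type*} [CommRing k] (M : Matrix (Fin 3) (Fin 3) k)
    (q : MvPolynomial (Fin 3) k) (a b : Fin 3 → k) :
    restrictLine (substM M q) a b = restrictLine q (M.mulVec a) (M.mulVec b) := by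
  unfold substM restrictLine
  rw [comp_aeval_apply]
  congr 2
  funext i
  simp only [Matrix.mulVec, dotProduct, Fin.sum_univ_three, map_add, map_mul, aeval_X, aeval_C,
    algebraMap_eq]
  ring

theorem restrict_comb {k : Type*} [CommRing k]
    (q : MvPolynomial (Fin 3) k) (a b u v : Fin 3 → k) (α β γ δ : k)
    (hu : ∀ i, u i = α * a i + β * b i) (hv : ∀ i, v i = γ * a i + δ * b i) :
    restrictLine q u v =
      aeval ![(C α * X 0 + C γ * X 1 : MvPolynomial (Fin 2) k), C β * X 0 + C δ * X 1]
        (restrictLine q a b) := by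
  unfold restrictLine
  rw [comp_aeval_apply]
  congr 2
  funext i
  simp only [hu, hv, map_add, map_mul, aeval_X, aeval_C, algebraMap_eq, Matrix.cons_val_zero,
    Matrix.cons_val_one]
  ring

theorem eval_restrict {k : Type*} [CommRing k]
    (q : MvPolynomial (Fin 3) k) (a b : Fin 3 → k) (s t : k) :
    eval ![s, t] (restrictLine q a b) = eval (fun i => s * a i + t * b i) q := by
  unfold restrictLine
  rw [← aeval_eq_eval, comp_aeval_apply, aeval_eq_eval]
  congr 2
  funext i
  simp [aeval_eq_eval]
  ring

theorem span_lemma {k : Type*} [Field k] (d a b u : Fin 3 → k) (hd : d ≠ 0)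
    (hl : LinearIndependent k ![a, b]) (ha : dot3 d a = 0) (hb : dot3 d b = 0)
    (hu : dot3 d u = 0) : ∃ α β : k, ∀ i, u i = α * a i + β * b i := by
  have h1 : ∃ v, v ≠ 0 ∧ (Matrix.of ![a, b, u]).mulVec v = 0 := by
    refine ⟨d, hd, ?_⟩
    unfold dot3 at ha hb hu
    funext i
    fin_cases i <;> simp [Matrix.mulVec, dotProduct, Fin.sum_univ_three]
    · linear_combination ha
    · linear_combination hb
    · linear_combination hu
  rw [Matrix.exists_mulVec_eq_zero_iff, ← Matrix.exists_vecMul_eq_zero_iff] at h1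
  obtain ⟨w, hw, h⟩ := h1
  have h' : ∀ i, w 0 * a i + w 1 * b i + w 2 * u i = 0 := by
    intro i
    have := congrFun h i
    simpa [Matrix.vecMul, dotProduct, Fin.sum_univ_three] using this
  rw [LinearIndependent.pair_iff] at hl
  have hw2 : w 2 ≠ 0 := by
    intro h2
    have := hl (w 0) (w 1) (by
      funext i
      have := h' i
      simp [h2] at this
      simpa using this)
    apply hw
    funext i
    fin_cases i
    · exact this.1
    · exact this.2
    · exact h2
  refine ⟨-w 0 / w 2, -w 1 / w 2, fun i => ?_⟩
  field_simp
  linear_combination h' i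

theorem hyper_restrict {k : Type*} [Field k] [IsAlgClosed k] (q : MvPolynomial (Fin 3) k)
    (d p u v : Fin 3 → k) (h : IsHyperinflectionLineAt q d p)
    (hu : dot3 d u = 0) (hv : dot3 d v = 0) :
    ∃ m n : k, restrictLine q u v = (C m * X 0 + C n * X 1) ^ 4 := by
  obtain ⟨hd, a, b, s, t, hl, ha, hb, -, -, -, -, c, L, -, hL, -, hr, -⟩ := h
  obtain ⟨α, β, h1⟩ := span_lemma d a b u hd hl ha hb hu
  obtain ⟨γ, δ, h2⟩ := span_lemma d a b v hd hl ha hb hv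
  obtain ⟨x, y, rfl⟩ := linear_exp L hL
  obtain ⟨z, hz⟩ := IsAlgClosed.exists_pow_nat_eq c (n := 4) (by norm_num)
  refine ⟨z * (x * α + y * β), z * (x * γ + y * δ), ?_⟩
  rw [restrict_comb q a b u v α β γ δ h1 h2, hr, ← hz]
  simp only [map_add, map_mul, map_pow, aeval_X, aeval_C, algebraMap_eq, Matrix.cons_val_zero,
    Matrix.cons_val_one]
  ring

theorem pderiv_substM {k : Type*} [CommRing k] (M : Matrix (Fin 3) (Fin 3) k)
    (q : MvPolynomial (Fin 3) k) (j : Fin 3) :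
    pderiv j (substM M q) = ∑ i, C (M i j) * substM M (pderiv i q) := by
  induction q using MvPolynomial.induction_on with
  | C a => simp [substM]
  | add p q hp hq =>
    have : substM M (p + q) = substM M p + substM M q := by simp [substM]
    rw [this, map_add, hp, hq, ← Finset.sum_add_distrib]
    refine Finset.sum_congr rfl fun i _ => ?_
    simp [substM, mul_add]
  | mul_X p l hp =>
    have h1 : ∀ p q : MvPolynomial (Fin 3) k, substM M (p * q) = substM M p * substM M q := by
      intro p q; simp [substM]
    have h2 : ∀ p q : MvPolynomial (Fin 3) k, substM M (p + q) = substM M p + substM M q := by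
      intro p q; simp [substM]
    have h3 : substM M (X l) = ∑ j : Fin 3, C (M l j) * X j := by simp [substM]
    have h4 : pderiv j (∑ j : Fin 3, C (M l j) * X j) = C (M l j) := by
      simp only [Fin.sum_univ_three]
      fin_cases j <;> simp
    have h5 : ∀ i, substM M (pderiv i (X l)) = if i = l then 1 else 0 := by
      intro i
      rw [pderiv_X]
      by_cases h : i = l
      · subst h; simp [substM]
      · simp [substM, h, Ne.symm h]
        try simp [eq_comm, h]
    rw [h1, Derivation.leibniz, h3, h4, hp]
    simp only [Derivation.leibniz, smul_eq_mul, h2, h1, h5, mul_add, Finset.sum_add_distrib]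
    congr 1
    · simp [mul_comm]
    · rw [Finset.mul_sum, h3]
      refine Finset.sum_congr rfl fun i _ => ?_
      ring

theorem eval_substM {k : Type*} [CommRing k] (M : Matrix (Fin 3) (Fin 3) k)
    (q : MvPolynomial (Fin 3) k) (x : Fin 3 → k) :
    eval x (substM M q) = eval (M.mulVec x) q := by
  unfold substM
  rw [← aeval_eq_eval, comp_aeval_apply, aeval_eq_eval]
  congr 2
  funext i
  simp [aeval_eq_eval, Matrix.mulVec, dotProduct]

theorem smooth_substM {k : Type*} [Field k] (M : Matrix (Fin 3) (Fin 3) k) (hM : IsUnit M.det)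
    (q : MvPolynomial (Fin 3) k)
    (hsm : ∀ pt : Fin 3 → k, pt ≠ 0 → eval pt q = 0 → ∃ i, eval pt (pderiv i q) ≠ 0) :
    ∀ pt : Fin 3 → k, pt ≠ 0 → eval pt (substM M q) = 0 →
      ∃ i, eval pt (pderiv i (substM M q)) ≠ 0 := by
  intro pt hpt h0
  rw [eval_substM] at h0
  have hdet : M.det ≠ 0 := hM.ne_zero
  have h1 : M.mulVec pt ≠ 0 := by
    intro h
    exact hpt (Matrix.eq_zero_of_mulVec_eq_zero hdet h)
  obtain ⟨i, hi⟩ := hsm _ h1 h0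
  by_contra! hall
  have h2 : Matrix.vecMul (fun i => eval (M.mulVec pt) (pderiv i q)) M = 0 := by
    funext j
    have := hall j
    rw [pderiv_substM] at this
    simp only [map_sum, map_mul, eval_C, eval_substM] at this
    simp only [Matrix.vecMul, dotProduct, Pi.zero_apply]
    rw [← this]
    exact Finset.sum_congr rfl fun i _ => mul_comm _ _
  exact hi (congrFun (Matrix.eq_zero_of_vecMul_eq_zero hdet h2) i)

theorem hyper_of_restrict {k : Type*} [Field k] (q : MvPolynomial (Fin 3) k)
    (hsm : ∀ pt : Fin 3 → k, pt ≠ 0 → eval pt q = 0 → ∃ i, eval pt (pderiv i q) ≠ 0)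
    (d d' d'' a b : Fin 3 → k) (c e : k) (hd : d ≠ 0) (hc : c ≠ 0)
    (ha : dot3 d a = 0) (hb : dot3 d b = 0) (ha' : dot3 d' a = 1) (hb' : dot3 d' b = 0)
    (ha'' : dot3 d'' a = 0) (hb'' : dot3 d'' b = 1)
    (hr : restrictLine q a b = C c * (X 0 - C e * X 1) ^ 4) :
    IsHyperinflectionLineAt q d (fun i => e * a i + 1 * b i) := by
  have hp : eval (fun i => e * a i + 1 * b i) q = 0 := by
    rw [← eval_restrict, hr]; simp
  have hne : (fun i => e * a i + 1 * b i) ≠ 0 := by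
    intro h
    have h0 := congrFun h 0
    have h1 := congrFun h 1
    have h2 := congrFun h 2
    simp only [Pi.zero_apply] at h0 h1 h2
    unfold dot3 at ha'' hb''
    apply one_ne_zero (α := k)
    linear_combination d'' 0 * h0 + d'' 1 * h1 + d'' 2 * h2 - hb'' - e * ha''
  refine ⟨hd, a, b, e, 1, ?_, ha, hb, by simp, fun i => rfl, hp, hsm _ hne hp, c,
    X 0 - C e * X 1, hc, ?_, ?_, hr, by simp⟩
  · rw [LinearIndependent.pair_iff]
    intro s t h
    have h0 := congrFun h 0
    have h1 := congrFun h 1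
    have h2 := congrFun h 2
    simp only [Pi.zero_apply, Pi.add_apply, Pi.smul_apply, smul_eq_mul] at h0 h1 h2
    unfold dot3 at ha'' hb'' ha' hb'
    constructor
    · linear_combination d' 0 * h0 + d' 1 * h1 + d' 2 * h2 - s * ha' - t * hb'
    · linear_combination d'' 0 * h0 + d'' 1 * h1 + d'' 2 * h2 - s * ha'' - t * hb''
  · refine (isHomogeneous_X k 0).sub ?_
    simpa using (isHomogeneous_C (Fin 2) e).mul (isHomogeneous_X k 1)
  · intro h
    have := congrArg (eval ![1, 0]) h
    simp at this

theorem homog_substM {k : Type*} [CommRing k] (M : Matrix (Fin 3) (Fin 3) k)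
    (q : MvPolynomial (Fin 3) k) (h : q.IsHomogeneous 4) : (substM M q).IsHomogeneous 4 := by
  unfold substM
  have := h.aeval (fun i => ∑ j : Fin 3, C (M i j) * X j) (n := 1) (fun i => by
    refine IsHomogeneous.sum _ _ _ fun j _ => ?_
    simpa using (isHomogeneous_C (Fin 3) (M i j)).mul (isHomogeneous_X k j))
  simpa using this

theorem restrict01 {k : Type*} [CommRing k]
    (a b c ab3 ab2 ab1 ac3 ac2 ac1 bc3 bc2 bc1 l m n : k) :
    restrictLine (Q15 a b c ab3 ab2 ab1 ac3 ac2 ac1 bc3 bc2 bc1 l m n) ![1,0,0] ![0,1,0] =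
      B5 a ab3 ab2 ab1 b := by
  simp [restrictLine, Q15, B5, algebraMap_eq]; ring

theorem restrict02 {k : Type*} [CommRing k]
    (a b c ab3 ab2 ab1 ac3 ac2 ac1 bc3 bc2 bc1 l m n : k) :
    restrictLine (Q15 a b c ab3 ab2 ab1 ac3 ac2 ac1 bc3 bc2 bc1 l m n) ![1,0,0] ![0,0,1] =
      B5 a ac3 ac2 ac1 c := by
  simp [restrictLine, Q15, B5, algebraMap_eq]; ring

theorem restrict12 {k : Type*} [CommRing k]
    (a b c ab3 ab2 ab1 ac3 ac2 ac1 bc3 bc2 bc1 l m n : k) :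
    restrictLine (Q15 a b c ab3 ab2 ab1 ac3 ac2 ac1 bc3 bc2 bc1 l m n) ![0,1,0] ![0,0,1] =
      B5 b bc3 bc2 bc1 c := by
  simp [restrictLine, Q15, B5, algebraMap_eq]; ring

theorem substM_diag {k : Type*} [CommRing k]
    (a b c ab3 ab2 ab1 ac3 ac2 ac1 bc3 bc2 bc1 l m n x y z : k) :
    substM (Matrix.diagonal ![x, y, z])
      (Q15 a b c ab3 ab2 ab1 ac3 ac2 ac1 bc3 bc2 bc1 l m n) =
    Q15 (a*x^4) (b*y^4) (c*z^4) (ab3*x^3*y) (ab2*x^2*y^2) (ab1*x*y^3)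
      (ac3*x^3*z) (ac2*x^2*z^2) (ac1*x*z^3) (bc3*y^3*z) (bc2*y^2*z^2) (bc1*y*z^3)
      (l*x^2*y*z) (m*x*y^2*z) (n*x*y*z^2) := by
  simp [substM, Q15, Fin.sum_univ_three, Matrix.diagonal, algebraMap_eq]; ring

theorem qeps_eq {k : Type*} [CommRing k] (ε lam mu nu : k) (h : ε ^ 4 = 1) :
    qeps ε + X 0 * X 1 * X 2 * (C lam * X 0 + C mu * X 1 + C nu * X 2) =
      Q15 1 1 1 (-4) 6 (-4) (-4) 6 (-4) (-4 * ε) (6 * ε ^ 2) (-4 * ε ^ 3) lam mu nu := by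
  have h' : (C ε : MvPolynomial (Fin 3) k) ^ 4 = 1 := by rw [← map_pow, h, map_one]
  simp only [qeps, Q15, map_mul, map_neg, map_pow, map_ofNat, map_one]
  linear_combination (X 2 ^ 4) * h'

theorem coef_ne {k : Type*} [Field k] (q : MvPolynomial (Fin 3) k)
    (a b c ab3 ab2 ab1 ac3 ac2 ac1 bc3 bc2 bc1 l m n : k)
    (hq : q = Q15 a b c ab3 ab2 ab1 ac3 ac2 ac1 bc3 bc2 bc1 l m n)
    (hsm : ∀ pt : Fin 3 → k, pt ≠ 0 → eval pt q = 0 → ∃ i, eval pt (pderiv i q) ≠ 0) :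
    ¬ (a = 0 ∧ ab3 = 0 ∧ ac3 = 0) ∧ ¬ (b = 0 ∧ ab1 = 0 ∧ bc3 = 0) ∧
      ¬ (c = 0 ∧ ac1 = 0 ∧ bc1 = 0) := by
  subst hq
  refine ⟨?_, ?_, ?_⟩
  · rintro ⟨rfl, rfl, rfl⟩
    obtain ⟨i, hi⟩ := hsm ![1, 0, 0] (fun h => by simpa using congrFun h 0) (by simp [Q15])
    apply hi
    fin_cases i <;> simp [Q15, Derivation.leibniz, Derivation.leibniz_pow, pderiv_X]
  · rintro ⟨rfl, rfl, rfl⟩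
    obtain ⟨i, hi⟩ := hsm ![0, 1, 0] (fun h => by simpa using congrFun h 1) (by simp [Q15])
    apply hi
    fin_cases i <;> simp [Q15, Derivation.leibniz, Derivation.leibniz_pow, pderiv_X]
  · rintro ⟨rfl, rfl, rfl⟩
    obtain ⟨i, hi⟩ := hsm ![0, 0, 1] (fun h => by simpa using congrFun h 2) (by simp [Q15])
    apply hi
    fin_cases i <;> simp [Q15, Derivation.leibniz, Derivation.leibniz_pow, pderiv_X]

theorem normalize_quartic {k : Type*} [Field k] (l m n m0 m1 n0 n2 r1 r2 : k)
    (hm0 : m0 ≠ 0) (hm1 : m1 ≠ 0) (hn0 : n0 ≠ 0) (hn2 : n2 ≠ 0) (hr1 : r1 ≠ 0)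
    (hA : m0 ^ 4 = n0 ^ 4) (hB : m1 ^ 4 = r1 ^ 4) (hC : n2 ^ 4 = r2 ^ 4) :
    ∃ x y z ε lam mu nu : k, x ≠ 0 ∧ y ≠ 0 ∧ z ≠ 0 ∧ ε ^ 4 = 1 ∧
      substM (Matrix.diagonal ![x, y, z])
        (Q15 (m0 ^ 4) (m1 ^ 4) (n2 ^ 4)
          (4 * m0 ^ 3 * m1) (6 * m0 ^ 2 * m1 ^ 2) (4 * m0 * m1 ^ 3)
          (4 * n0 ^ 3 * n2) (6 * n0 ^ 2 * n2 ^ 2) (4 * n0 * n2 ^ 3)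
          (4 * r1 ^ 3 * r2) (6 * r1 ^ 2 * r2 ^ 2) (4 * r1 * r2 ^ 3) l m n) =
      Q15 1 1 1 (-4) 6 (-4) (-4) 6 (-4) (-4 * ε) (6 * ε ^ 2) (-4 * ε ^ 3) lam mu nu := by
  obtain ⟨ω, hω⟩ : ∃ ω, ω = n0 / m0 := ⟨_, rfl⟩
  obtain ⟨τ, hτ⟩ : ∃ τ, τ = r1 / m1 := ⟨_, rfl⟩
  obtain ⟨σ, hσ⟩ : ∃ σ, σ = r2 / n2 := ⟨_, rfl⟩
  have hn : n0 = ω * m0 := by rw [hω]; field_simp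
  have hr : r1 = τ * m1 := by rw [hτ]; field_simp
  have hs : r2 = σ * n2 := by rw [hσ]; field_simp
  have hω4 : ω ^ 4 = 1 := by rw [hω, div_pow, hA]; field_simp
  have hτ4 : τ ^ 4 = 1 := by rw [hτ, div_pow, hB]; field_simp
  have hσ4 : σ ^ 4 = 1 := by rw [hσ, div_pow, ← hC]; field_simp
  refine ⟨m0⁻¹, -m1⁻¹, -(ω * n2⁻¹), -(σ * τ ^ 3 * ω),
    l * m0⁻¹ ^ 2 * -m1⁻¹ * -(ω * n2⁻¹), m * m0⁻¹ * (-m1⁻¹) ^ 2 * -(ω * n2⁻¹),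
    n * m0⁻¹ * -m1⁻¹ * (-(ω * n2⁻¹)) ^ 2, inv_ne_zero hm0,
    neg_ne_zero.2 (inv_ne_zero hm1), ?_, ?_, ?_⟩
  rotate_left 2
  · rw [substM_diag]
    clear hω hτ hσ hA hB hC
    subst hn hr hs
    congr 1
    all_goals field_simp
    all_goals try ring1
    · linear_combination hω4
    · linear_combination -4 * hω4
    · linear_combination 6 * hω4
    · linear_combination -4 * hω4
    · linear_combination -(6 * τ ^ 2 * σ ^ 2 * ω ^ 2) * hτ4
    · linear_combination -(4 * τ * σ ^ 3 * ω ^ 3 * (τ ^ 4 + 1)) * hτ4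
  · rw [neg_ne_zero]
    exact mul_ne_zero (by rw [hω]; exact div_ne_zero hn0 hm0) (inv_ne_zero hn2)
  · linear_combination (τ ^ 12 * ω ^ 4) * hσ4 + ω ^ 4 * (τ ^ 8 + τ ^ 4 + 1) * hτ4 + hω4

theorem forward {k : Type*} [Field k] [IsAlgClosed k]
    (q : MvPolynomial (Fin 3) k) (hq4 : q.IsHomogeneous 4)
    (hsm : ∀ pt : Fin 3 → k, pt ≠ 0 → eval pt q = 0 → ∃ i, eval pt (pderiv i q) ≠ 0)
    (d₁ d₂ d₃ p₁ p₂ p₃ : Fin 3 → k)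
    (H1 : IsHyperinflectionLineAt q d₁ p₁) (H2 : IsHyperinflectionLineAt q d₂ p₂)
    (H3 : IsHyperinflectionLineAt q d₃ p₃)
    (hnc : ¬ ∃ pt : Fin 3 → k, pt ≠ 0 ∧ dot3 d₁ pt = 0 ∧ dot3 d₂ pt = 0 ∧ dot3 d₃ pt = 0) :
    ∃ (M : Matrix (Fin 3) (Fin 3) k) (c ε lam mu nu : k), IsUnit M.det ∧ c ≠ 0 ∧
        ε ^ 4 = 1 ∧
        C c * substM M q =
          qeps ε + X 0 * X 1 * X 2 * (C lam * X 0 + C mu * X 1 + C nu * X 2) := by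
  obtain ⟨D, hD⟩ : ∃ D : Matrix (Fin 3) (Fin 3) k, D = Matrix.of ![d₁, d₂, d₃] := ⟨_, rfl⟩
  have hdot : ∀ v, D.mulVec v = ![dot3 d₁ v, dot3 d₂ v, dot3 d₃ v] := by
    intro v
    funext i
    rw [hD]
    fin_cases i <;> simp [Matrix.mulVec, dotProduct, Fin.sum_univ_three, dot3]
  have hDdet : D.det ≠ 0 := by
    intro h
    obtain ⟨v, hv, h0⟩ := Matrix.exists_mulVec_eq_zero_iff.2 h
    rw [hdot] at h0
    exact hnc ⟨v, hv, congrFun h0 0, congrFun h0 1, congrFun h0 2⟩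
  obtain ⟨M, hMdef⟩ : ∃ M : Matrix (Fin 3) (Fin 3) k, M = D⁻¹ := ⟨_, rfl⟩
  have hDM : D * M = 1 := by rw [hMdef]; exact Matrix.mul_nonsing_inv D (Ne.isUnit hDdet)
  have hMdet : IsUnit M.det := by
    have := congrArg Matrix.det hDM
    rw [Matrix.det_mul, Matrix.det_one] at this
    exact IsUnit.of_mul_eq_one_right _ this
  have hdot' : ∀ v, ![dot3 d₁ (M.mulVec v), dot3 d₂ (M.mulVec v), dot3 d₃ (M.mulVec v)] = v := by
    intro v
    rw [← hdot, Matrix.mulVec_mulVec, hDM, Matrix.one_mulVec]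
  have e0 := hdot' ![1,0,0]
  have e1 := hdot' ![0,1,0]
  have e2 := hdot' ![0,0,1]
  obtain ⟨r1, r2, hr⟩ := hyper_restrict q d₁ p₁ (M.mulVec ![0,1,0]) (M.mulVec ![0,0,1]) H1
    (congrFun e1 0) (congrFun e2 0)
  obtain ⟨n0, n2, hn⟩ := hyper_restrict q d₂ p₂ (M.mulVec ![1,0,0]) (M.mulVec ![0,0,1]) H2
    (congrFun e0 1) (congrFun e2 1)
  obtain ⟨m0, m1, hm⟩ := hyper_restrict q d₃ p₃ (M.mulVec ![1,0,0]) (M.mulVec ![0,1,0]) H3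
    (congrFun e0 2) (congrFun e1 2)
  obtain ⟨a, b, c, ab3, ab2, ab1, ac3, ac2, ac1, bc3, bc2, bc1, l, m, n, hQ⟩ :=
    quartic_exp _ (homog_substM M q hq4)
  have hne := coef_ne _ _ _ _ _ _ _ _ _ _ _ _ _ _ _ _ hQ (smooth_substM M hMdet q hsm)
  rw [← restrict_substM, hQ, restrict12, B5_pow] at hr
  rw [← restrict_substM, hQ, restrict02, B5_pow] at hn
  rw [← restrict_substM, hQ, restrict01, B5_pow] at hm
  obtain ⟨rfl, rfl, rfl, rfl, rfl⟩ := B5_inj hm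
  obtain ⟨hA, rfl, rfl, rfl, rfl⟩ := B5_inj hn
  obtain ⟨hB, rfl, rfl, rfl, hC⟩ := B5_inj hr
  obtain ⟨hn1, hn2', hn3⟩ := hne
  have z4 : ∀ x y : k, x ^ 4 = y ^ 4 → x = 0 → y = 0 := by
    rintro x y h rfl
    exact pow_eq_zero_iff (n := 4) (by norm_num) |>.1 (by rw [← h]; simp)
  have hm0 : m0 ≠ 0 := by
    intro h
    have := z4 _ _ hA h
    exact hn1 (by simp [h, this])
  have hm1 : m1 ≠ 0 := by
    intro h
    have := z4 _ _ hB h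
    exact hn2' (by simp [h, this])
  have hn2 : n2 ≠ 0 := by
    intro h
    have := z4 _ _ hC h
    exact hn3 (by simp [h, this])
  have hn0 : n0 ≠ 0 := fun h => hm0 (z4 _ _ hA.symm h)
  have hr1 : r1 ≠ 0 := fun h => hm1 (z4 _ _ hB.symm h)
  obtain ⟨x, y, z, ε, lam, mu, nu, hx, hy, hz, hε, hfin⟩ :=
    normalize_quartic l m n m0 m1 n0 n2 r1 r2 hm0 hm1 hn0 hn2 hr1 hA hB hC
  refine ⟨M * Matrix.diagonal ![x, y, z], 1, ε, lam, mu, nu, ?_, one_ne_zero, hε, ?_⟩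
  · rw [Matrix.det_mul, Matrix.det_diagonal]
    refine hMdet.mul (Ne.isUnit ?_)
    simp [Fin.prod_univ_three, hx, hy, hz]
  · rw [substM_mul, hQ, hfin, qeps_eq ε lam mu nu hε]
    simp

theorem backward {k : Type*} [Field k]
    (q : MvPolynomial (Fin 3) k)
    (hsm : ∀ pt : Fin 3 → k, pt ≠ 0 → eval pt q = 0 → ∃ i, eval pt (pderiv i q) ≠ 0)
    (M : Matrix (Fin 3) (Fin 3) k) (c ε lam mu nu : k) (hM : IsUnit M.det) (hc : c ≠ 0)
    (hε : ε ^ 4 = 1)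
    (h : C c * substM M q =
          qeps ε + X 0 * X 1 * X 2 * (C lam * X 0 + C mu * X 1 + C nu * X 2)) :
    ∃ d₁ d₂ d₃ p₁ p₂ p₃ : Fin 3 → k,
        IsHyperinflectionLineAt q d₁ p₁ ∧ IsHyperinflectionLineAt q d₂ p₂ ∧
        IsHyperinflectionLineAt q d₃ p₃ ∧
        (¬ ∃ c : k, d₁ = c • d₂) ∧ (¬ ∃ c : k, d₁ = c • d₃) ∧ (¬ ∃ c : k, d₂ = c • d₃) ∧
        ¬ ∃ pt : Fin 3 → k, pt ≠ 0 ∧ dot3 d₁ pt = 0 ∧ dot3 d₂ pt = 0 ∧ dot3 d₃ pt = 0 := by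
  obtain ⟨D, hD⟩ : ∃ D : Fin 3 → Fin 3 → k, D = fun i j => M⁻¹ i j := ⟨_, rfl⟩
  have hdot : ∀ v i, dot3 (D i) v = (M⁻¹).mulVec v i := by
    intro v i
    simp [hD, Matrix.mulVec, dotProduct, Fin.sum_univ_three, dot3]
  have hdot' : ∀ v i, dot3 (D i) (M.mulVec v) = v i := by
    intro v i
    rw [hdot, Matrix.mulVec_mulVec, Matrix.nonsing_inv_mul M hM, Matrix.one_mulVec]
  have hsub : substM M q = C c⁻¹ * Q15 1 1 1 (-4) 6 (-4) (-4) 6 (-4) (-4 * ε) (6 * ε ^ 2)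
      (-4 * ε ^ 3) lam mu nu := by
    rw [← qeps_eq ε lam mu nu hε, ← h, ← mul_assoc, ← map_mul, inv_mul_cancel₀ hc]
    simp
  have hCr : ∀ (p : MvPolynomial (Fin 3) k) a b, restrictLine (C c⁻¹ * p) a b =
      C c⁻¹ * restrictLine p a b := by
    intro p a b; simp [restrictLine, algebraMap_eq]
  have hB : ∀ e : k, e ^ 4 = 1 →
      B5 1 (-4 * e) (6 * e ^ 2) (-4 * e ^ 3) 1 = (X 0 - C e * X 1) ^ 4 := by
    intro e he
    have := B5_pow 1 (-e)
    rw [map_one, one_mul, map_neg, neg_mul, ← sub_eq_add_neg] at this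
    rw [this]
    congr 1
    all_goals first | ring1 | linear_combination -he
  have r01 : restrictLine q (M.mulVec ![1,0,0]) (M.mulVec ![0,1,0]) =
      C c⁻¹ * (X 0 - C 1 * X 1) ^ 4 := by
    rw [← restrict_substM, hsub, hCr, restrict01, ← hB 1 (by simp)]; simp
  have r02 : restrictLine q (M.mulVec ![1,0,0]) (M.mulVec ![0,0,1]) =
      C c⁻¹ * (X 0 - C 1 * X 1) ^ 4 := by
    rw [← restrict_substM, hsub, hCr, restrict02, ← hB 1 (by simp)]; simp
  have r12 : restrictLine q (M.mulVec ![0,1,0]) (M.mulVec ![0,0,1]) =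
      C c⁻¹ * (X 0 - C ε * X 1) ^ 4 := by
    rw [← restrict_substM, hsub, hCr, restrict12, ← hB ε hε]
  have hne : ∀ i, D i ≠ 0 := by
    intro i hi
    have := hdot' (fun _ => 1) i
    rw [hi] at this
    simp [dot3] at this
  have hprop : ∀ i j, i ≠ j → ¬ ∃ c : k, D i = c • D j := by
    rintro i j hij ⟨c, hc⟩
    have h1 := hdot' (Pi.single i 1) i
    have h2 := hdot' (Pi.single i 1) j
    rw [Pi.single_eq_same] at h1
    rw [Pi.single_eq_of_ne hij.symm] at h2
    rw [hc] at h1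
    apply one_ne_zero (α := k)
    rw [← h1]
    simp only [dot3, Pi.smul_apply, smul_eq_mul] at h2 ⊢
    linear_combination c * h2
  have hc' := inv_ne_zero hc
  refine ⟨D 0, D 1, D 2, _, _, _,
    hyper_of_restrict q hsm (D 0) (D 1) (D 2) _ _ _ _ (hne 0) hc' ?_ ?_ ?_ ?_ ?_ ?_ r12,
    hyper_of_restrict q hsm (D 1) (D 0) (D 2) _ _ _ _ (hne 1) hc' ?_ ?_ ?_ ?_ ?_ ?_ r02,
    hyper_of_restrict q hsm (D 2) (D 0) (D 1) _ _ _ _ (hne 2) hc' ?_ ?_ ?_ ?_ ?_ ?_ r01,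
    hprop 0 1 (by decide), hprop 0 2 (by decide), hprop 1 2 (by decide), ?_⟩
  on_goal 19 =>
    rintro ⟨pt, hpt, h0, h1, h2⟩
    apply hpt
    have hz : (M⁻¹).mulVec pt = 0 := by
      funext i
      rw [← hdot]
      fin_cases i
      · exact h0
      · exact h1
      · exact h2
    have : M.mulVec ((M⁻¹).mulVec pt) = pt := by
      rw [Matrix.mulVec_mulVec, Matrix.mul_nonsing_inv M hM, Matrix.one_mulVec]
    rw [← this, hz, Matrix.mulVec_zero]
  all_goals rw [hdot']; simp

/-- A smooth plane quartic over an algebraically closed field of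
characteristic coprime to `6` has three non-concurrent hyperinflection lines if and only if,
up to an invertible linear change of coordinates and rescaling, its equation is
`q_ε + xyz(λx + μy + νz)` for some `ε⁴ = 1` and `λ, μ, ν`. -/
theorem stmt15 {k : Type*} [Field k] [IsAlgClosed k] (h6 : (6 : k) ≠ 0)
    (q : MvPolynomial (Fin 3) k) (hq0 : q ≠ 0) (hq4 : q.IsHomogeneous 4)
    (hsm : ∀ pt : Fin 3 → k, pt ≠ 0 → eval pt q = 0 → ∃ i, eval pt (pderiv i q) ≠ 0) :
    (∃ d₁ d₂ d₃ p₁ p₂ p₃ : Fin 3 → k,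
        IsHyperinflectionLineAt q d₁ p₁ ∧ IsHyperinflectionLineAt q d₂ p₂ ∧
        IsHyperinflectionLineAt q d₃ p₃ ∧
        (¬ ∃ c : k, d₁ = c • d₂) ∧ (¬ ∃ c : k, d₁ = c • d₃) ∧ (¬ ∃ c : k, d₂ = c • d₃) ∧
        ¬ ∃ pt : Fin 3 → k, pt ≠ 0 ∧ dot3 d₁ pt = 0 ∧ dot3 d₂ pt = 0 ∧ dot3 d₃ pt = 0) ↔
      ∃ (M : Matrix (Fin 3) (Fin 3) k) (c ε lam mu nu : k), IsUnit M.det ∧ c ≠ 0 ∧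
        ε ^ 4 = 1 ∧
        C c * substM M q =
          qeps ε + X 0 * X 1 * X 2 * (C lam * X 0 + C mu * X 1 + C nu * X 2) := by
  constructor
  · rintro ⟨d₁, d₂, d₃, p₁, p₂, p₃, H1, H2, H3, -, -, -, hnc⟩
    exact forward q hq4 hsm d₁ d₂ d₃ p₁ p₂ p₃ H1 H2 H3 hnc
  · rintro ⟨M, c, ε, lam, mu, nu, hM, hc, hε, h⟩
    exact backward q hsm M c ε lam mu nu hM hc hε h
end
end

section
/- Let k be an algebraically closed field of characteristic coprime to 6. Let p₁, …, p₅ ∈ P²(k) be distinct points and let ℓ₁, …, ℓ₅ ⊂ P²_k be distinct lines such that pᵢ lies on ℓᵢ for each i. If C = {q_C = 0} and D = {q_D = 0} are smooth plane quartics such that, for every i ∈ {1,…,5}, ℓᵢ is a hyperinflection line of C with hyperinflection point pᵢ and also a hyperinflection line of D with hyperinflection point pᵢ, then C = D, i.e. q_C and q_D are proportional. -/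
open MvPolynomial

noncomputable section

lemma hx_span {k : Type*} [Field k] {d a b e : Fin 3 → k} (hd : d ≠ 0)
    (hab : LinearIndependent k ![a, b]) (ha : dot3 d a = 0) (hb : dot3 d b = 0)
    (he : dot3 d e = 0) : ∃ s t : k, e = s • a + t • b := by
  by_contra hne
  have hnm : e ∉ Submodule.span k (Set.range ![a, b]) := by
    intro h
    apply hne
    rw [Matrix.range_cons, Matrix.range_cons, Matrix.range_empty, Set.union_empty,
      Set.singleton_union, Submodule.mem_span_pair] at h
    obtain ⟨s, t, h⟩ := h
    exact ⟨s, t, h.symm⟩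
  have hli : LinearIndependent k (Matrix.of ![e, a, b]).row :=
    linearIndependent_finCons.2 ⟨hab, hnm⟩
  rw [Matrix.linearIndependent_rows_iff_isUnit, Matrix.isUnit_iff_isUnit_det] at hli
  apply hd
  apply Matrix.eq_zero_of_mulVec_eq_zero hli.ne_zero
  ext i
  simp only [dot3] at ha hb he
  fin_cases i <;> simp [Matrix.mulVec, dotProduct, Fin.sum_univ_three]
  · linear_combination he
  · linear_combination ha
  · linear_combination hb

lemma hx_linear {k : Type*} [Field k] {L : MvPolynomial (Fin 2) k} (hL : L.IsHomogeneous 1) :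
    ∃ l m : k, L = C l * X 0 + C m * X 1 := by
  have h : L ∈ homogeneousSubmodule (Fin 2) k 1 := hL
  rw [homogeneousSubmodule_one_eq_span_X] at h
  have hr : Set.range (X : Fin 2 → MvPolynomial (Fin 2) k) = {X 0, X 1} := by
    ext x; simp [Fin.exists_fin_two, eq_comm]
  rw [hr, Submodule.mem_span_pair] at h
  obtain ⟨l, m, h⟩ := h
  exact ⟨l, m, by rw [← h, smul_eq_C_mul, smul_eq_C_mul]⟩

lemma hx_restrict {k : Type*} [Field k] (q : MvPolynomial (Fin 3) k) (a b : Fin 3 → k)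
    (s t : k) : eval ![s, t] (restrictLine q a b) = eval (s • a + t • b) q := by
  have h : ((eval ![s, t]).comp
      (aeval (R := k) (fun i => C (a i) * X 0 + C (b i) * X 1 :
        Fin 3 → MvPolynomial (Fin 2) k)).toRingHom) = eval (s • a + t • b) := by
    apply MvPolynomial.ringHom_ext
    · intro r; simp
    · intro i; simp [mul_comm]
  exact congrArg (fun f => f q) h

lemma hx_hyper {k : Type*} [Field k] {q : MvPolynomial (Fin 3) k} {d p e : Fin 3 → k}
    (h : IsHyperinflectionLineAt q d p) (he : dot3 d e = 0)
    (hep : LinearIndependent k ![p, e]) :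
    eval e q ≠ 0 ∧ ∀ α β : k, eval (α • p + β • e) q = β ^ 4 * eval e q := by
  obtain ⟨hd, a, b, s, t, hab, ha, hb, hst, hp, -, -, c, L, hc, hL, hL0, hr, hz⟩ := h
  obtain ⟨s', t', hest⟩ := hx_span hd hab ha hb he
  obtain ⟨l, m, rfl⟩ := hx_linear hL
  have hpst : p = s • a + t • b := by ext i; simp [hp i]
  simp only [map_add, map_mul, eval_C, eval_X, Matrix.cons_val_zero, Matrix.cons_val_one] at hz
  have key : ∀ α β : k, eval (α • p + β • e) q = c * (β * (l * s' + m * t')) ^ 4 := by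
    intro α β
    have h1 : α • p + β • e = (α * s + β * s') • a + (α * t + β * t') • b := by
      rw [hpst, hest]; ext i; simp; ring
    rw [h1, ← hx_restrict, hr]
    simp only [map_add, map_mul, map_pow, eval_C, eval_X, Matrix.cons_val_zero,
      Matrix.cons_val_one]
    congr 2
    linear_combination α * hz
  have hke := key 0 1
  simp only [zero_smul, one_smul, zero_add, one_mul] at hke
  refine ⟨?_, fun α β => by rw [key, hke]; ring⟩
  rw [hke]
  refine mul_ne_zero hc (pow_ne_zero _ fun h0 => ?_)
  have hdet : s * t' - t * s' = 0 := by
    by_contra hdet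
    apply hL0
    have hl : l = 0 := by
      have : l * (s * t' - t * s') = 0 := by linear_combination t' * hz - t * h0
      exact (mul_eq_zero.1 this).resolve_right hdet
    have hm : m = 0 := by
      have : m * (s * t' - t * s') = 0 := by linear_combination s * h0 - s' * hz
      exact (mul_eq_zero.1 this).resolve_right hdet
    simp [hl, hm]
  rw [LinearIndependent.pair_iff] at hep
  have h1 := hep s' (-s) (by
    rw [hpst, hest]; ext i; simp; linear_combination (-(b i)) * hdet)
  have h2 := hep t' (-t) (by
    rw [hpst, hest]; ext i; simp; linear_combination (a i) * hdet)
  exact hst (by simp [neg_eq_zero.1 h1.2, neg_eq_zero.1 h2.2])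

/-- The linear form with coefficient vector `d`. -/
def hxForm {k : Type*} [Field k] (d : Fin 3 → k) : MvPolynomial (Fin 3) k :=
  C (d 0) * X 0 + C (d 1) * X 1 + C (d 2) * X 2

lemma hx_form_eval {k : Type*} [Field k] (d x : Fin 3 → k) : eval x (hxForm d) = dot3 d x := by
  simp [hxForm, dot3]

lemma hx_form_ne {k : Type*} [Field k] {d : Fin 3 → k} (hd : d ≠ 0) : hxForm d ≠ 0 := by
  intro h
  apply hd
  ext i
  have h1 := hx_form_eval d (Pi.single i 1)
  rw [h] at h1
  fin_cases i <;> simpa [dot3, eq_comm] using h1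

lemma hx_exists {k : Type*} [Field k] [Infinite k] {q : MvPolynomial (Fin 3) k} (hq : q ≠ 0) :
    ∃ x, eval x q ≠ 0 := by
  by_contra! h
  exact hq (MvPolynomial.funext fun x => by simpa using h x)

/-- A form of degree at most four vanishing on five distinct lines is zero. -/
lemma hx_five {k : Type*} [Field k] [Infinite k] {r : MvPolynomial (Fin 3) k}
    (hr : r.IsHomogeneous 4) (d : Fin 5 → Fin 3 → k)
    (hd : ∀ i j, i ≠ j → LinearIndependent k ![d i, d j])
    (hv : ∀ i x, dot3 (d i) x = 0 → eval x r = 0) : r = 0 := by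
  have hd0 : ∀ i, d i ≠ 0 := fun i => (hd i (i + 1) (by fin_cases i <;> decide)).ne_zero 0
  obtain ⟨v, hvv⟩ := hx_exists (q := ∏ i, hxForm (d i))
    (Finset.prod_ne_zero_iff.2 fun i _ => hx_form_ne (hd0 i))
  rw [map_prod, Finset.prod_ne_zero_iff] at hvv
  simp only [Finset.mem_univ, forall_const, hx_form_eval] at hvv
  by_contra hr0
  let P : Fin 5 → Fin 5 → Fin 3 → k := fun i j =>
    dot3 (d j) v • d i - dot3 (d i) v • d j
  obtain ⟨x, hx⟩ := hx_exists
    (q := r * ∏ i, ∏ j, if i = j then 1 else hxForm (P i j)) (by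
    refine mul_ne_zero hr0 (Finset.prod_ne_zero_iff.2 fun i _ =>
      Finset.prod_ne_zero_iff.2 fun j _ => ?_)
    split_ifs with hij
    · exact one_ne_zero
    · apply hx_form_ne
      intro h0
      have := (LinearIndependent.pair_iff.1 (hd i j hij)) (dot3 (d j) v) (-dot3 (d i) v)
        (by rw [neg_smul, ← sub_eq_add_neg]; exact h0)
      exact hvv j this.1)
  rw [map_mul] at hx
  have hx1 := left_ne_zero_of_mul hx
  have hx2 := right_ne_zero_of_mul hx
  simp only [map_prod, Finset.prod_ne_zero_iff, Finset.mem_univ, forall_const] at hx2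
  let g : Polynomial k := aeval (fun i => Polynomial.C (x i) + Polynomial.C (v i) * Polynomial.X) r
  have hg : ∀ t, g.eval t = eval (x + t • v) r := by
    intro t
    have h : (Polynomial.evalRingHom t).comp
      (aeval (R := k) (fun i => Polynomial.C (x i) + Polynomial.C (v i) * Polynomial.X :
        Fin 3 → Polynomial k)).toRingHom = eval (x + t • v) := by
      apply MvPolynomial.ringHom_ext
      · intro r; simp
      · intro i; simp [mul_comm t]
    exact congrArg (fun f => f r) h
  have hdeg : g.natDegree ≤ 4 * 1 := by
    apply MvPolynomial.aeval_natDegree_le _ hr.totalDegree_le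
    intro i
    compute_degree
  have hlin : ∀ i t, dot3 (d i) (x + t • v) = dot3 (d i) x + t * dot3 (d i) v := by
    intro i t; simp only [dot3, Pi.add_apply, Pi.smul_apply, smul_eq_mul]; ring
  have hg0 : g = 0 := by
    apply Polynomial.eq_zero_of_natDegree_lt_card_of_eval_eq_zero g
      (f := fun i : Fin 5 => -(dot3 (d i) x) / dot3 (d i) v)
    · intro i j hij
      by_contra hne
      have h := hx2 i j
      rw [if_neg hne, hx_form_eval] at h
      apply h
      have hi := hvv i
      have hj := hvv j
      simp only [] at hij
      rw [div_eq_div_iff hi hj] at hij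
      have : dot3 (P i j) x = dot3 (d j) v * dot3 (d i) x - dot3 (d i) v * dot3 (d j) x := by
        simp only [P, dot3, Pi.sub_apply, Pi.smul_apply, smul_eq_mul]; ring
      rw [this]
      linear_combination -hij
    · intro i
      rw [hg]
      apply hv i
      rw [hlin, div_mul_cancel₀ _ (hvv i)]
      ring
    · simp; omega
  apply hx1
  have := hg 0
  rw [hg0] at this
  simpa using this.symm

lemma hx_pair {k : Type*} [Field k] {a b : Fin 3 → k} (hb : b ≠ 0)
    (h : ¬ ∃ c : k, a = c • b) : LinearIndependent k ![b, a] := by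
  rw [LinearIndependent.pair_iff' hb]
  intro c hc
  exact h ⟨c, hc.symm⟩

/-- Over an algebraically closed field of characteristic coprime to `6`,
there is at most one smooth plane quartic with five prescribed hyperinflection lines
`ℓ₁, …, ℓ₅` (distinct) and corresponding hyperinflection points `p₁, …, p₅` (distinct,
with `pᵢ ∈ ℓᵢ`). -/
theorem stmt17 {k : Type*} [Field k] [IsAlgClosed k] (h6 : (6 : k) ≠ 0)
    (p d : Fin 5 → Fin 3 → k)
    (hp0 : ∀ i, p i ≠ 0)
    (hpdist : ∀ i j, i ≠ j → ¬ ∃ c : k, p i = c • p j)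
    (hddist : ∀ i j, i ≠ j → ¬ ∃ c : k, d i = c • d j)
    (hinc : ∀ i, dot3 (d i) (p i) = 0)
    (qC qD : MvPolynomial (Fin 3) k)
    (hC0 : qC ≠ 0) (hC4 : qC.IsHomogeneous 4)
    (hCsm : ∀ pt : Fin 3 → k, pt ≠ 0 → eval pt qC = 0 → ∃ i, eval pt (pderiv i qC) ≠ 0)
    (hD0 : qD ≠ 0) (hD4 : qD.IsHomogeneous 4)
    (hDsm : ∀ pt : Fin 3 → k, pt ≠ 0 → eval pt qD = 0 → ∃ i, eval pt (pderiv i qD) ≠ 0)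
    (hChyp : ∀ i, IsHyperinflectionLineAt qC (d i) (p i))
    (hDhyp : ∀ i, IsHyperinflectionLineAt qD (d i) (p i)) :
    ∃ c : k, c ≠ 0 ∧ qD = c • qC := by
  have hinf : Infinite k := IsAlgClosed.instInfinite
  have hd0 : ∀ i, d i ≠ 0 := fun i => (hChyp i).1
  -- a second point on the first line
  obtain ⟨e, he, hpe⟩ : ∃ e, dot3 (d 0) e = 0 ∧ LinearIndependent k ![p 0, e] := by
    obtain ⟨-, a, b, -, -, hab, ha, hb, -⟩ := hChyp 0
    by_contra! hcon
    have hca := hcon a ha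
    have hcb := hcon b hb
    rw [LinearIndependent.pair_iff' (hp0 0)] at hca hcb
    push Not at hca hcb
    obtain ⟨x, hx⟩ := hca
    obtain ⟨y, hy⟩ := hcb
    rw [LinearIndependent.pair_iff] at hab
    have h1 := hab y (-x) (by rw [← hx, ← hy]; ext i; simp; ring)
    have h2 := hab 1 0 (by simp [← hx, neg_eq_zero.1 h1.2])
    exact one_ne_zero h2.1
  obtain ⟨hCe, hCl⟩ := hx_hyper (hChyp 0) he hpe
  obtain ⟨hDe, hDl⟩ := hx_hyper (hDhyp 0) he hpe
  have hc0 : eval e qD / eval e qC ≠ 0 := div_ne_zero hDe hCe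
  refine ⟨eval e qD / eval e qC, hc0, ?_⟩
  set c := eval e qD / eval e qC with hc
  have hce : eval e qD = c * eval e qC := by rw [hc, div_mul_cancel₀ _ hCe]
  have hline0 : ∀ x, dot3 (d 0) x = 0 → eval x (qD - C c * qC) = 0 := by
    intro x hx
    obtain ⟨α, β, rfl⟩ := hx_span (hd0 0) hpe (hinc 0) he hx
    rw [map_sub, map_mul, eval_C, hCl, hDl, hce]
    ring
  rw [← sub_eq_zero, smul_eq_C_mul]
  refine hx_five (hD4.sub (hC4.C_mul c)) d
    (fun i j hij => hx_pair (hd0 i) (hddist j i hij.symm)) ?_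
  intro i
  by_cases hi : i = 0
  · subst hi; exact hline0
  intro x hx
  have hdd : LinearIndependent k ![d 0, d i] := hx_pair (hd0 0) (hddist i 0 hi)
  have hm0 : crossProduct (d 0) (d i) ≠ 0 := crossProduct_ne_zero_iff_linearIndependent.2 hdd
  set m := crossProduct (d 0) (d i) with hm
  have hm1 : dot3 (d 0) m = 0 := by
    simp [hm, cross_apply, dot3]; ring
  have hm2 : dot3 (d i) m = 0 := by
    simp [hm, cross_apply, dot3]; ring
  have hqpi : eval (p i) qC = 0 := by
    obtain ⟨-, a, b, s, t, -, -, -, -, -, h, -⟩ := hChyp i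
    exact h
  have hpm : LinearIndependent k ![p i, m] := by
    apply hx_pair (hp0 i)
    rintro ⟨z, hz⟩
    have hz0 : z ≠ 0 := by
      rintro rfl
      exact hm0 (by rw [hz, zero_smul])
    have hpi0 : dot3 (d 0) (p i) = 0 := by
      have h1 : dot3 (d 0) m = z * dot3 (d 0) (p i) := by
        rw [hz]; simp only [dot3, Pi.smul_apply, smul_eq_mul]; ring
      rw [h1] at hm1
      exact (mul_eq_zero.1 hm1).resolve_left hz0
    exact (hx_hyper (hChyp 0) hpi0 (hx_pair (hp0 0) (hpdist i 0 hi))).1 hqpi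
  obtain ⟨-, hCi⟩ := hx_hyper (hChyp i) hm2 hpm
  obtain ⟨-, hDi⟩ := hx_hyper (hDhyp i) hm2 hpm
  obtain ⟨α, β, rfl⟩ := hx_span (hd0 i) hpm (hinc i) hm2 hx
  have h0 := hline0 m hm1
  rw [map_sub, map_mul, eval_C] at h0
  rw [map_sub, map_mul, eval_C, hCi, hDi]
  linear_combination β ^ 4 * h0
end
end

section
/- Let k be an algebraically closed field of characteristic coprime to 6 and let C = {q_C = 0} and D = {q_D = 0} be smooth plane quartics. Suppose the ideals (H(q_C), K(q_C)) and (H(q_D), K(q_D)) of k[u,v,w] are equal (the inflection schemes of C and D coincide) and that C has at least 5 distinct hyperinflection lines. Then C = D, i.e. q_C and q_D are proportional. -/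
open MvPolynomial

noncomputable section

universe u

/-! ### Auxiliary material -/

/-- value of a binary quartic with coefficients `f` -/
def qf {R : Type*} [CommRing R] (f : Fin 5 → R) (y z : R) : R :=
  f 0 * y ^ 4 + f 1 * y ^ 3 * z + f 2 * y ^ 2 * z ^ 2 + f 3 * y * z ^ 3 + f 4 * z ^ 4

/-- restriction to a line over an algebra -/
def rest {k R : Type*} [CommRing k] [CommRing R] [Algebra k R] (q : MvPolynomial (Fin 3) k)
    (a b : Fin 3 → R) : MvPolynomial (Fin 2) R :=
  aeval (fun i => C (a i) * X 0 + C (b i) * X 1) q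

/-- coefficients of the restriction -/
def cf {k R : Type*} [CommRing k] [CommRing R] [Algebra k R] (q : MvPolynomial (Fin 3) k)
    (a b : Fin 3 → R) (i : Fin 5) : R := binCoeff (rest q a b) i

lemma rest_hom {k R : Type*} [CommRing k] [CommRing R] [Algebra k R] {q : MvPolynomial (Fin 3) k}
    {n : ℕ} (hq : q.IsHomogeneous n) (a b : Fin 3 → R) : (rest q a b).IsHomogeneous n := by
  have := hq.aeval (fun i => (C (a i) * X 0 + C (b i) * X 1 : MvPolynomial (Fin 2) R)) (n := 1)
    (fun i => (isHomogeneous_C_mul_X _ _).add (isHomogeneous_C_mul_X _ _))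
  simpa [rest] using this

lemma bin_expand {R : Type*} [CommRing R] {p : MvPolynomial (Fin 2) R} {n : ℕ}
    (hp : p.IsHomogeneous n) :
    p = ∑ i ∈ Finset.range (n + 1),
      C (coeff (Finsupp.single 0 (n - i) + Finsupp.single 1 i) p) * X 0 ^ (n - i) * X 1 ^ i := by
  ext m
  have hX : ∀ i (c : R), (C c * X 0 ^ (n - i) * X 1 ^ i : MvPolynomial (Fin 2) R)
      = monomial (Finsupp.single 0 (n - i) + Finsupp.single 1 i) c := by
    intro i c
    rw [X_pow_eq_monomial, X_pow_eq_monomial, mul_assoc, monomial_mul, C_mul_monomial]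
    simp
  simp only [hX, coeff_sum, coeff_monomial]
  by_cases hm : m.degree = n
  · have hd : m 0 + m 1 = n := by
      rw [← hm, Finsupp.degree_eq_sum]; simp [Fin.sum_univ_two]
    have key : ∀ i ∈ Finset.range (n + 1),
        (Finsupp.single 0 (n - i) + Finsupp.single 1 i : Fin 2 →₀ ℕ) = m ↔ i = m 1 := by
      intro i hi
      have hi := Finset.mem_range.1 hi
      constructor
      · intro h; rw [← h]; simp
      · intro h; ext j; fin_cases j <;> simp <;> omega
    rw [Finset.sum_eq_single (m 1)]
    · have h1 := (key (m 1) (by simp; omega)).2 rfl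
      rw [if_pos h1, h1]
    · intro b hb hb'
      rw [if_neg]; rw [key b hb]; exact hb'
    · intro h; exfalso; apply h; simp; omega
  · rw [hp.coeff_eq_zero hm, Finset.sum_eq_zero]
    intro i hi
    have hi := Finset.mem_range.1 hi
    rw [if_neg]
    intro h; apply hm; rw [← h, Finsupp.degree_eq_sum]; simp [Fin.sum_univ_two]; omega

lemma binCoeff_binQuartic {R : Type*} [CommRing R] (f : Fin 5 → R) (i : Fin 5) :
    binCoeff (binQuartic f) i = f i := by
  have hX : ∀ (i : Fin 5) (c : R),
      (C c * X 0 ^ (4 - (i : ℕ)) * X 1 ^ (i : ℕ) : MvPolynomial (Fin 2) R)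
      = monomial (Finsupp.single 0 (4 - (i : ℕ)) + Finsupp.single 1 (i : ℕ)) c := by
    intro i c
    rw [X_pow_eq_monomial, X_pow_eq_monomial, mul_assoc, monomial_mul, C_mul_monomial]
    simp
  simp only [binCoeff, binQuartic, hX, coeff_sum, coeff_monomial]
  rw [Finset.sum_eq_single i]
  · simp
  · intro b _ hb
    rw [if_neg]
    intro h
    have := DFunLike.congr_fun h 1
    simp at this
    exact hb (Fin.ext this)
  · simp

lemma rest_eq {k R : Type*} [CommRing k] [CommRing R] [Algebra k R] {q : MvPolynomial (Fin 3) k}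
    (hq : q.IsHomogeneous 4) (a b : Fin 3 → R) : rest q a b = binQuartic (cf q a b) := by
  rw [bin_expand (rest_hom hq a b)]
  simp only [binQuartic, Finset.sum_range, cf, binCoeff]

lemma binQuartic_qf {R : Type*} [CommRing R] (f : Fin 5 → R) :
    binQuartic f = qf (fun i => C (f i)) (X 0) (X 1) := by
  simp [binQuartic, qf, Fin.sum_univ_five]
  
lemma cf_of_eq {k R : Type*} [CommRing k] [CommRing R] [Algebra k R] {q : MvPolynomial (Fin 3) k}
    (a b : Fin 3 → R) (f : Fin 5 → R) (h : rest q a b = qf (fun i => C (f i)) (X 0) (X 1)) :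
    cf q a b = f := by
  ext i
  rw [cf, h, ← binQuartic_qf, binCoeff_binQuartic]

lemma rest_map {k R B : Type*} [CommRing k] [CommRing R] [Algebra k R] [CommRing B] [Algebra k B]
    (φ : R →ₐ[k] B) (q : MvPolynomial (Fin 3) k) (a b : Fin 3 → R) (y z : B) :
    eval₂Hom (φ : R →+* B) ![y, z] (rest q a b)
      = aeval (fun i => φ (a i) * y + φ (b i) * z) q := by
  rw [rest, map_aeval, aeval_def, ← coe_eval₂Hom]
  congr 2
  · ext r
    rw [RingHom.comp_apply, IsScalarTower.algebraMap_apply k R (MvPolynomial (Fin 2) R),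
      MvPolynomial.algebraMap_eq]
    simp
  · ext i; simp

lemma ev {k R B : Type*} [CommRing k] [CommRing R] [Algebra k R] [CommRing B] [Algebra k B]
    (φ : R →ₐ[k] B) {q : MvPolynomial (Fin 3) k} (hq : q.IsHomogeneous 4) (a b : Fin 3 → R)
    (y z : B) :
    aeval (fun i => φ (a i) * y + φ (b i) * z) q = qf (fun i => φ (cf q a b i)) y z := by
  rw [← rest_map, rest_eq hq, binQuartic_qf]
  simp [qf]

lemma cf_map {k R B : Type*} [CommRing k] [CommRing R] [Algebra k R] [CommRing B] [Algebra k B]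
    (φ : R →ₐ[k] B) {q : MvPolynomial (Fin 3) k} (hq : q.IsHomogeneous 4) (a b : Fin 3 → R) :
    cf q (fun i => φ (a i)) (fun i => φ (b i)) = fun i => φ (cf q a b i) := by
  apply cf_of_eq
  have := ev ((IsScalarTower.toAlgHom k B (MvPolynomial (Fin 2) B)).comp φ) hq a b (X 0) (X 1)
  simpa [rest, MvPolynomial.algebraMap_eq] using this

lemma Sinv_map {R B : Type*} [CommRing R] [CommRing B] (φ : R →+* B) (f : Fin 5 → R) :
    φ (Sinv f) = Sinv (fun i => φ (f i)) := by
  simp [Sinv, map_ofNat]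

lemma Tinv_map {R B : Type*} [CommRing R] [CommRing B] (φ : R →+* B) (f : Fin 5 → R) :
    φ (Tinv f) = Tinv (fun i => φ (f i)) := by
  simp [Tinv, map_ofNat]

/-- transformed coefficients: `f (m y + n z, r y + s z)` -/
def tr {R : Type*} [CommRing R] (g : Fin 5 → R) (m n r s : R) : Fin 5 → R :=
  ![g 0 * m ^ 4 + g 1 * m ^ 3 * r + g 2 * m ^ 2 * r ^ 2 + g 3 * m * r ^ 3 + g 4 * r ^ 4,
    4 * g 0 * m ^ 3 * n + g 1 * (3 * m ^ 2 * n * r + m ^ 3 * s)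
      + g 2 * (2 * m * n * r ^ 2 + 2 * m ^ 2 * r * s)
      + g 3 * (n * r ^ 3 + 3 * m * r ^ 2 * s) + 4 * g 4 * r ^ 3 * s,
    6 * g 0 * m ^ 2 * n ^ 2 + g 1 * (3 * m * n ^ 2 * r + 3 * m ^ 2 * n * s)
      + g 2 * (n ^ 2 * r ^ 2 + 4 * m * n * r * s + m ^ 2 * s ^ 2)
      + g 3 * (3 * n * r ^ 2 * s + 3 * m * r * s ^ 2) + 6 * g 4 * r ^ 2 * s ^ 2,
    4 * g 0 * m * n ^ 3 + g 1 * (n ^ 3 * r + 3 * m * n ^ 2 * s)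
      + g 2 * (2 * n ^ 2 * r * s + 2 * m * n * s ^ 2)
      + g 3 * (3 * n * r * s ^ 2 + m * s ^ 3) + 4 * g 4 * r * s ^ 3,
    g 0 * n ^ 4 + g 1 * n ^ 3 * s + g 2 * n ^ 2 * s ^ 2 + g 3 * n * s ^ 3 + g 4 * s ^ 4]

lemma qf_tr {R : Type*} [CommRing R] (g : Fin 5 → R) (m n r s y z : R) :
    qf (tr g m n r s) y z = qf g (m * y + n * z) (r * y + s * z) := by
  simp [qf, tr]; ring

lemma Sinv_tr {R : Type*} [CommRing R] (g : Fin 5 → R) (m n r s : R) :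
    Sinv (tr g m n r s) = (m * s - n * r) ^ 4 * Sinv g := by
  simp [Sinv, tr]; ring

lemma Tinv_tr {R : Type*} [CommRing R] (g : Fin 5 → R) (m n r s : R) :
    Tinv (tr g m n r s) = (m * s - n * r) ^ 6 * Tinv g := by
  simp [Tinv, tr]; ring

lemma tr_map {R B : Type*} [CommRing R] [CommRing B] (φ : R →+* B) (g : Fin 5 → R) (m n r s : R) :
    (fun i => φ (tr g m n r s i)) = tr (fun i => φ (g i)) (φ m) (φ n) (φ r) (φ s) := by
  ext i
  fin_cases i <;> simp [tr, map_ofNat]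

lemma cf_tr {k R : Type*} [CommRing k] [CommRing R] [Algebra k R]
    {q : MvPolynomial (Fin 3) k} (hq : q.IsHomogeneous 4) (a b : Fin 3 → R) (m n r s : R) :
    cf q (fun i => m * a i + r * b i) (fun i => n * a i + s * b i) = tr (cf q a b) m n r s := by
  apply cf_of_eq
  rw [tr_map, qf_tr]
  have := ev (IsScalarTower.toAlgHom k R (MvPolynomial (Fin 2) R)) hq a b
    (C m * X 0 + C n * X 1) (C r * X 0 + C s * X 1)
  simp only [IsScalarTower.coe_toAlgHom', MvPolynomial.algebraMap_eq] at this
  rw [← this, rest]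
  have h2 : (fun i => C (m * a i + r * b i) * X 0 + C (n * a i + s * b i) * X 1 :
      Fin 3 → MvPolynomial (Fin 2) R) = fun i => C (a i) * (C m * X 0 + C n * X 1)
        + C (b i) * (C r * X 0 + C s * X 1) := by
    ext1 i
    simp only [map_add, map_mul]
    ring
  rw [h2]

lemma gsub_eq {k : Type*} [CommRing k] (q : MvPolynomial (Fin 3) k) :
    gsub q = rest q (![- X 1, X 0, 0] : Fin 3 → MvPolynomial (Fin 3) k) ![- X 2, 0, X 0] := by
  rw [gsub, rest]
  congr 2
  ext1 i
  fin_cases i <;> simp [sub_eq_add_neg]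
  ring

/-- cross product -/
def cr {R : Type*} [CommRing R] (a b : Fin 3 → R) : Fin 3 → R :=
  ![a 1 * b 2 - a 2 * b 1, a 2 * b 0 - a 0 * b 2, a 0 * b 1 - a 1 * b 0]

lemma cf_cross {k R : Type*} [CommRing k] [CommRing R] [Algebra k R]
    {q : MvPolynomial (Fin 3) k} (hq : q.IsHomogeneous 4) (a b : Fin 3 → R) :
    tr (cf q a b) (cr a b 0) 0 0 (cr a b 0) =
      tr (fun i => aeval (cr a b) (binCoeff (gsub q) i)) (a 1) (b 1) (a 2) (b 2) := by
  have h1 := cf_map (aeval (R := k) (cr a b)) hq ![- X 1, X 0, 0] ![- X 2, 0, X 0]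
  simp only [cf, ← gsub_eq] at h1
  rw [← h1]
  change _ = tr (cf q _ _) _ _ _ _
  rw [← cf_tr hq, ← cf_tr hq]
  congr 1
  · ext1 i
    fin_cases i <;> simp [cr] <;> ring
  · ext1 i
    fin_cases i <;> simp [cr] <;> ring

lemma S_cross {k R : Type*} [CommRing k] [CommRing R] [IsDomain R] [Algebra k R]
    {q : MvPolynomial (Fin 3) k} (hq : q.IsHomogeneous 4) {H : MvPolynomial (Fin 3) k}
    (hH : X 0 ^ 4 * H = SG q) (a b : Fin 3 → R) (h0 : cr a b 0 ≠ 0) :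
    Sinv (cf q a b) = aeval (cr a b) H := by
  have h := congrArg Sinv (cf_cross hq a b)
  have hH' := congrArg (aeval (cr a b)) hH
  rw [SG] at hH'
  have h3 := Sinv_map (aeval (R := k) (cr a b) : MvPolynomial (Fin 3) k →+* R)
    (fun i => binCoeff (gsub q) i)
  simp only [RingHom.coe_coe] at h3
  rw [h3] at hH'
  rw [Sinv_tr, Sinv_tr, ← hH'] at h
  simp only [map_mul, map_pow, aeval_X] at h
  have h4 : a 1 * b 2 - b 1 * a 2 = cr a b 0 := by simp [cr]; ring
  rw [h4] at h
  apply mul_left_cancel₀ (pow_ne_zero 8 h0)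
  linear_combination h

lemma T_cross {k R : Type*} [CommRing k] [CommRing R] [IsDomain R] [Algebra k R]
    {q : MvPolynomial (Fin 3) k} (hq : q.IsHomogeneous 4) {H : MvPolynomial (Fin 3) k}
    (hH : X 0 ^ 6 * H = TG q) (a b : Fin 3 → R) (h0 : cr a b 0 ≠ 0) :
    Tinv (cf q a b) = aeval (cr a b) H := by
  have h := congrArg Tinv (cf_cross hq a b)
  have hH' := congrArg (aeval (cr a b)) hH
  rw [TG] at hH'
  have h3 := Tinv_map (aeval (R := k) (cr a b) : MvPolynomial (Fin 3) k →+* R)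
    (fun i => binCoeff (gsub q) i)
  simp only [RingHom.coe_coe] at h3
  rw [h3] at hH'
  rw [Tinv_tr, Tinv_tr, ← hH'] at h
  simp only [map_mul, map_pow, aeval_X] at h
  have h4 : a 1 * b 2 - b 1 * a 2 = cr a b 0 := by simp [cr]; ring
  rw [h4] at h
  apply mul_left_cancel₀ (pow_ne_zero 12 h0)
  linear_combination h

/-- Taylor expansion to first order -/
lemma taylor {k B : Type*} [CommRing k] [CommRing B] [Algebra k B] (q : MvPolynomial (Fin 3) k)
    (P E : Fin 3 → B) (t : B) (ht : t * t = 0) :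
    aeval (fun i => P i + t * E i) q
      = aeval P q + t * ∑ i, E i * aeval P (pderiv i q) := by
  induction q using MvPolynomial.induction_on with
  | C a => simp
  | add p q hp hq =>
    simp only [map_add, hp, hq, mul_add, Finset.sum_add_distrib]; ring
  | mul_X p n hp =>
    simp only [map_mul, hp, aeval_X, Derivation.leibniz, map_add, smul_eq_mul, pderiv_X]
    fin_cases n <;> simp [Fin.sum_univ_three, Pi.single_apply]
    · linear_combination (E 0 * (E 0 * aeval P (pderiv 0 p) + E 1 * aeval P (pderiv 1 p)
        + E 2 * aeval P (pderiv 2 p))) * ht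
    · linear_combination (E 1 * (E 0 * aeval P (pderiv 0 p) + E 1 * aeval P (pderiv 1 p)
        + E 2 * aeval P (pderiv 2 p))) * ht
    · linear_combination (E 2 * (E 0 * aeval P (pderiv 0 p) + E 1 * aeval P (pderiv 1 p)
        + E 2 * aeval P (pderiv 2 p))) * ht

lemma root3 {k : Type*} [Field k] [IsAlgClosed k] (g0 g1 g2 g3 : k) :
    ∃ y z : k, (y ≠ 0 ∨ z ≠ 0) ∧ g0 * y ^ 3 + g1 * y ^ 2 * z + g2 * y * z ^ 2 + g3 * z ^ 3 = 0 := by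
  by_cases h : g0 = 0
  · exact ⟨1, 0, by simp, by simp [h]⟩
  · obtain ⟨y, hy⟩ := IsAlgClosed.exists_root
      (Polynomial.C g0 * Polynomial.X ^ 3 + Polynomial.C g1 * Polynomial.X ^ 2
        + Polynomial.C g2 * Polynomial.X + Polynomial.C g3)
      (by rw [Polynomial.degree_cubic h]; decide)
    refine ⟨y, 1, by simp, ?_⟩
    simp [Polynomial.IsRoot] at hy
    linear_combination hy

lemma root4 {k : Type*} [Field k] [IsAlgClosed k] (g0 g1 g2 g3 g4 : k) (h : g0 ≠ 0) :
    ∃ y : k, g0 * y ^ 4 + g1 * y ^ 3 + g2 * y ^ 2 + g3 * y + g4 = 0 := by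
  have hd : (Polynomial.C g0 * Polynomial.X ^ 4 + Polynomial.C g1 * Polynomial.X ^ 3
        + Polynomial.C g2 * Polynomial.X ^ 2 + Polynomial.C g3 * Polynomial.X
        + Polynomial.C g4).degree = 4 := by
    compute_degree!
  obtain ⟨y, hy⟩ := IsAlgClosed.exists_root _ (by rw [hd]; decide)
  refine ⟨y, ?_⟩
  simp [Polynomial.IsRoot] at hy
  linear_combination hy

/-- `f = (α y + β z)³ (γ y + δ z)` -/
def IsTriple {k : Type*} [Field k] (f : Fin 5 → k) : Prop :=
  ∃ α β γ δ : k, (α ≠ 0 ∨ β ≠ 0) ∧ f 0 = α ^ 3 * γ ∧ f 1 = α ^ 3 * δ + 3 * α ^ 2 * β * γ ∧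
    f 2 = 3 * α ^ 2 * β * δ + 3 * α * β ^ 2 * γ ∧ f 3 = 3 * α * β ^ 2 * δ + β ^ 3 * γ ∧
    f 4 = β ^ 3 * δ

lemma triple_of_zero {k : Type*} [Field k] (h6 : (6 : k) ≠ 0) (f : Fin 5 → k)
    (hS : Sinv f = 0) (hT : Tinv f = 0) (h0 : f 0 = 0) : IsTriple f := by
  have h3 : (3 : k) ≠ 0 := fun h => h6 (by linear_combination 2 * h)
  simp only [Sinv, Tinv, h0] at hS hT
  by_cases h1 : f 1 = 0
  · have h2 : f 2 = 0 := by
      rw [h1] at hS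
      have : f 2 ^ 2 = 0 := by linear_combination hS
      exact pow_eq_zero_iff (by norm_num) |>.1 this
    exact ⟨0, 1, f 3, f 4, by simp, by simp [h0], by simp [h1], by simp [h2], by simp, by simp⟩
  · refine ⟨1, f 2 / (3 * f 1), 0, f 1, by simp, by simp [h0], by simp, ?_, ?_, ?_⟩
    · field_simp; ring
    · field_simp; linear_combination (-9 * f 1 ^ 2) * hS
    · field_simp
      linear_combination -hT - 3 * f 2 * hS

lemma triple {k : Type*} [Field k] [IsAlgClosed k] (h6 : (6 : k) ≠ 0) (f : Fin 5 → k)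
    (hS : Sinv f = 0) (hT : Tinv f = 0) : IsTriple f := by
  by_cases h0 : f 0 = 0
  · exact triple_of_zero h6 f hS hT h0
  · obtain ⟨r, hr⟩ := root4 (f 0) (f 1) (f 2) (f 3) (f 4) h0
    obtain ⟨α, β, γ, δ, hn, e0, e1, e2, e3, e4⟩ := triple_of_zero h6 (tr f r 1 1 0)
      (by rw [Sinv_tr, hS, mul_zero]) (by rw [Tinv_tr, hT, mul_zero])
      (by simp [tr]; linear_combination hr)
    simp [tr] at e0 e1 e2 e3 e4
    refine ⟨β, α - r * β, δ, γ - r * δ, ?_, ?_, ?_, ?_, ?_, ?_⟩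
    · by_cases hb : β = 0
      · right; subst hb; simpa using hn
      · exact Or.inl hb
    · linear_combination e4
    · linear_combination e3 - 4 * r * e4
    · linear_combination e2 - 3 * r * e3 + 6 * r ^ 2 * e4
    · linear_combination e1 - 2 * r * e2 + 3 * r ^ 2 * e3 - 4 * r ^ 3 * e4
    · linear_combination e0 - r * e1 + r ^ 2 * e2 - r ^ 3 * e3 + r ^ 4 * e4

lemma key {k : Type*} [Field k] [IsAlgClosed k] (h6 : (6 : k) ≠ 0) (f : Fin 5 → k)
    (g0 g1 g2 g3 : k) (hS : Sinv f = 0) (hT : Tinv f = 0)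
    (hdS : 12 * f 0 * g3 - 3 * f 1 * g2 - 3 * f 3 * g0 + 2 * f 2 * g1 = 0)
    (hdT : 72 * (f 0 * f 2 * g3 + f 0 * g1 * f 4) - 54 * f 0 * f 3 * g2
      - 27 * (2 * f 1 * g0 * f 4 + f 1 ^ 2 * g3)
      + 9 * (g0 * f 2 * f 3 + f 1 * g1 * f 3 + f 1 * f 2 * g2) - 6 * f 2 ^ 2 * g1 = 0)
    (hsm : ∀ y z : k, (y ≠ 0 ∨ z ≠ 0) → qf f y z = 0 →
      4 * f 0 * y ^ 3 + 3 * f 1 * y ^ 2 * z + 2 * f 2 * y * z ^ 2 + f 3 * z ^ 3 = 0 →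
      f 1 * y ^ 3 + 2 * f 2 * y ^ 2 * z + 3 * f 3 * y * z ^ 2 + 4 * f 4 * z ^ 3 = 0 →
      g0 * y ^ 3 + g1 * y ^ 2 * z + g2 * y * z ^ 2 + g3 * z ^ 3 ≠ 0) :
    f 0 = 0 ∧ f 1 = 0 ∧ f 2 = 0 ∧ f 3 = 0 ∧ f 4 ≠ 0 := by
  have h3 : (3 : k) ≠ 0 := fun h => h6 (by linear_combination 2 * h)
  have h2 : (2 : k) ≠ 0 := fun h => h6 (by linear_combination 3 * h)
  have hne : ¬ (f 0 = 0 ∧ f 1 = 0 ∧ f 2 = 0 ∧ f 3 = 0 ∧ f 4 = 0) := by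
    rintro ⟨e0, e1, e2, e3, e4⟩
    obtain ⟨y, z, hyz, hg⟩ := root3 g0 g1 g2 g3
    exact hsm y z hyz (by simp [qf, *]) (by simp [*]) (by simp [*]) hg
  obtain ⟨α, β, γ, δ, hn, e0, e1, e2, e3, e4⟩ := triple h6 f hS hT
  have hroot := hsm (-β) α (by
      rcases hn with h | h
      · exact Or.inr h
      · exact Or.inl (neg_ne_zero.2 h))
    (by simp only [qf, e0, e1, e2, e3, e4]; ring) (by simp only [e0, e1, e2, e3, e4]; ring)
    (by simp only [e0, e1, e2, e3, e4]; ring)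
  by_cases hα : α = 0
  · subst hα
    have hβ : β ≠ 0 := by simpa using hn
    simp at e0 e1 e2 e3 hroot
    have hγ : γ = 0 := by
      rw [e0, e1, e2, e3] at hdS
      have : (3 * β ^ 3 * g0) * γ = 0 := by linear_combination -hdS
      have hne' : 3 * β ^ 3 * g0 ≠ 0 := mul_ne_zero (mul_ne_zero h3 (pow_ne_zero _ hβ)) hroot.1
      exact (mul_eq_zero.1 this).resolve_left hne'
    have e3' : f 3 = 0 := by rw [e3, hγ]; simp
    exact ⟨e0, e1, e2, e3', fun h => hne ⟨e0, e1, e2, e3', h⟩⟩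
  · exfalso
    rw [e0, e1, e2, e3, e4] at hdT
    rw [e0, e1, e2, e3] at hdS
    set h := g0 * (-β) ^ 3 + g1 * (-β) ^ 2 * α + g2 * (-β) * α ^ 2 + g3 * α ^ 3 with hh
    have hδ : α * δ - β * γ = 0 := by
      have : (27 * α * h) * (α * δ - β * γ) ^ 2 = 0 := by
        rw [hh]; linear_combination -hdT
      have h27 : (27 : k) ≠ 0 := by
        have := pow_ne_zero 3 h3; norm_num at this; exact this
      have := (mul_eq_zero.1 this).resolve_left (mul_ne_zero (mul_ne_zero h27 hα) hroot)
      exact pow_eq_zero_iff (by norm_num) |>.1 this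
    have hδ' : δ = β * γ / α := by field_simp; linear_combination hδ
    have hγ : γ = 0 := by
      rw [hδ'] at hdS
      have : (12 * h) * γ = 0 := by
        rw [hh]
        field_simp at hdS
        linear_combination hdS
      have h12 : (12 : k) ≠ 0 := by
        have := mul_ne_zero h6 h2; norm_num at this; exact this
      exact (mul_eq_zero.1 this).resolve_left (mul_ne_zero h12 hroot)
    rw [hγ] at hδ'
    simp at hδ'
    exact hne (by simp [e0, e1, e2, e3, e4, hγ, hδ'])

lemma ev3 {k : Type u} [CommRing k] {q : MvPolynomial (Fin 3) k} (hq : q.IsHomogeneous 4)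
    (a b e : Fin 3 → k) : ∃ g0 g1 g2 g3 : k, ∀ (B : Type u) [CommRing B] [Algebra k B] (y z : B),
      ∑ j, algebraMap k B (e j) *
        aeval (fun i => algebraMap k B (a i) * y + algebraMap k B (b i) * z) (pderiv j q)
      = algebraMap k B g0 * y ^ 3 + algebraMap k B g1 * y ^ 2 * z + algebraMap k B g2 * y * z ^ 2
        + algebraMap k B g3 * z ^ 3 := by
  set p : MvPolynomial (Fin 2) k := ∑ j, C (e j) * rest (pderiv j q) a b with hp
  have hph : p.IsHomogeneous 3 :=
    IsHomogeneous.sum _ _ _ (fun j _ => (rest_hom hq.pderiv a b).C_mul _)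
  refine ⟨coeff (Finsupp.single 0 (3 - 0) + Finsupp.single 1 0) p,
    coeff (Finsupp.single 0 (3 - 1) + Finsupp.single 1 1) p,
    coeff (Finsupp.single 0 (3 - 2) + Finsupp.single 1 2) p,
    coeff (Finsupp.single 0 (3 - 3) + Finsupp.single 1 3) p, ?_⟩
  intro B _ _ y z
  have h1 : ∑ j, algebraMap k B (e j) *
        aeval (fun i => algebraMap k B (a i) * y + algebraMap k B (b i) * z) (pderiv j q)
      = eval₂Hom (algebraMap k B) ![y, z] p := by
    rw [hp, map_sum]
    refine Finset.sum_congr rfl fun j _ => ?_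
    have := rest_map (Algebra.ofId k B) (pderiv j q) a b y z
    simp only [Algebra.ofId_apply] at this
    rw [map_mul, ← this]
    simp
  rw [h1]
  conv_lhs => rw [bin_expand hph]
  simp only [Finset.sum_range_succ, Finset.sum_range_zero, map_add, map_mul, map_pow, map_zero,
    coe_eval₂Hom, eval₂_C, eval₂_X, zero_add]
  simp

lemma cf_dual {k : Type u} [CommRing k] {q : MvPolynomial (Fin 3) k} (hq : q.IsHomogeneous 4)
    (a b e : Fin 3 → k) : ∃ g0 g1 g2 g3 : k,
      (∀ y z : k, ∑ j, e j * eval (fun i => a i * y + b i * z) (pderiv j q)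
        = g0 * y ^ 3 + g1 * y ^ 2 * z + g2 * y * z ^ 2 + g3 * z ^ 3) ∧
      ∀ (D : Type u) [CommRing D] [Algebra k D] (t : D), t * t = 0 →
      cf q (fun i => algebraMap k D (a i)) (fun i => algebraMap k D (b i) + t * algebraMap k D (e i))
        = fun i => algebraMap k D (cf q a b i) + t * algebraMap k D ((![0, g0, g1, g2, g3] : Fin 5 → k) i) := by
  obtain ⟨g0, g1, g2, g3, hg⟩ := ev3 hq a b e
  refine ⟨g0, g1, g2, g3, fun y z => ?_, ?_⟩
  · have := hg k y z
    simpa [aeval_eq_eval] using this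
  intro D _ _ t ht
  apply cf_of_eq
  have h1 := taylor q (fun i => algebraMap k (MvPolynomial (Fin 2) D) (a i) * X 0
    + algebraMap k (MvPolynomial (Fin 2) D) (b i) * X 1)
    (fun i => algebraMap k (MvPolynomial (Fin 2) D) (e i)) (C t * X 1)
    (by
      have : (C t * C t : MvPolynomial (Fin 2) D) = 0 := by rw [← C_mul, ht, C_0]
      linear_combination (X 1 ^ 2) * this)
  rw [hg] at h1
  have h2 := ev (Algebra.ofId k (MvPolynomial (Fin 2) D)) hq a b (X 0) (X 1)
  simp only [Algebra.ofId_apply] at h2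
  rw [h2] at h1
  have h3 : ∀ x : k, algebraMap k (MvPolynomial (Fin 2) D) x = C (algebraMap k D x) := by
    intro x
    rw [IsScalarTower.algebraMap_apply k D, MvPolynomial.algebraMap_eq]
  simp only [h3] at h1
  have h4 : rest q (fun i => algebraMap k D (a i)) (fun i => algebraMap k D (b i) + t * algebraMap k D (e i))
    = aeval (fun i => C (algebraMap k D (a i)) * X 0 + C (algebraMap k D (b i)) * X 1
      + C t * X 1 * C (algebraMap k D (e i))) q := by
    rw [rest]
    congr 2
    ext1 i
    simp only [map_add, map_mul]; ring
  rw [h4, h1]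
  simp [qf]
  ring

lemma dual_ext {k : Type*} [CommRing k] {x y : k}
    (h : algebraMap k (DualNumber k) x + DualNumber.eps * algebraMap k (DualNumber k) y = 0) :
    x = 0 ∧ y = 0 := by
  have h1 := congrArg TrivSqZeroExt.fst h
  have h2 := congrArg TrivSqZeroExt.snd h
  simp [TrivSqZeroExt.algebraMap_eq_inl] at h1 h2
  exact ⟨h1, h2⟩

lemma dual_ext2 {k : Type*} [CommRing k] {y : k}
    (h : DualNumber.eps * algebraMap k (DualNumber k) y = 0) : y = 0 :=
  (dual_ext (x := 0) (by rw [map_zero, zero_add, h])).2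

lemma eps2 {k : Type*} [CommRing k] : (DualNumber.eps : DualNumber k) * DualNumber.eps = 0 :=
  DualNumber.eps_mul_eps

lemma grad {k : Type u} [CommRing k] {q : MvPolynomial (Fin 3) k} (hq : q.IsHomogeneous 4)
    (a b : Fin 3 → k) (y z : k) :
    ∑ j, a j * eval (fun i => a i * y + b i * z) (pderiv j q) =
      4 * cf q a b 0 * y ^ 3 + 3 * cf q a b 1 * y ^ 2 * z + 2 * cf q a b 2 * y * z ^ 2
        + cf q a b 3 * z ^ 3 ∧
    ∑ j, b j * eval (fun i => a i * y + b i * z) (pderiv j q) =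
      cf q a b 1 * y ^ 3 + 2 * cf q a b 2 * y ^ 2 * z + 3 * cf q a b 3 * y * z ^ 2
        + 4 * cf q a b 4 * z ^ 3 := by
  have h0 := ev (AlgHom.id k k) hq a b y z
  have am : ∀ p : MvPolynomial (Fin 3) k,
      aeval (fun i => algebraMap k (DualNumber k) (a i * y + b i * z)) p
      = algebraMap k (DualNumber k) (eval (fun i => a i * y + b i * z) p) := by
    intro p
    rw [← aeval_eq_eval, ← aeval_algebraMap_apply]; rfl
  simp [aeval_eq_eval] at h0
  constructor
  · have h1 := taylor q (fun i => algebraMap k (DualNumber k) (a i * y + b i * z))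
      (fun i => algebraMap k (DualNumber k) (a i)) DualNumber.eps eps2
    have h2 := ev (Algebra.ofId k (DualNumber k)) hq a b (algebraMap k _ y + DualNumber.eps)
      (algebraMap k _ z)
    simp only [Algebra.ofId_apply] at h2
    have h3 : (fun i => algebraMap k (DualNumber k) (a i * y + b i * z)
        + DualNumber.eps * algebraMap k (DualNumber k) (a i))
        = fun i => algebraMap k (DualNumber k) (a i) * (algebraMap k _ y + DualNumber.eps)
          + algebraMap k (DualNumber k) (b i) * algebraMap k _ z := by
      ext1 i; simp only [map_add, map_mul]; ring
    rw [h3, h2] at h1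
    simp only [am, h0, ← map_mul, ← map_sum] at h1
    have h4 : qf (fun i => algebraMap k (DualNumber k) (cf q a b i))
        (algebraMap k _ y + DualNumber.eps) (algebraMap k _ z)
        = algebraMap k _ (qf (cf q a b) y z) + DualNumber.eps * algebraMap k _ (
          4 * cf q a b 0 * y ^ 3 + 3 * cf q a b 1 * y ^ 2 * z + 2 * cf q a b 2 * y * z ^ 2
        + cf q a b 3 * z ^ 3) := by
      have := eps2 (k := k)
      have h3' : (DualNumber.eps : DualNumber k) ^ 2 = 0 := by rw [pow_two, this]
      have h3'' : (DualNumber.eps : DualNumber k) ^ 3 = 0 := by rw [pow_succ, h3', zero_mul]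
      have h34 : (DualNumber.eps : DualNumber k) ^ 4 = 0 := by rw [pow_succ, h3'', zero_mul]
      simp only [qf, map_add, map_mul, map_pow, map_ofNat]
      ring_nf
      simp only [h3', h3'', h34]
      ring
    rw [h4] at h1
    have h6 := sub_eq_zero.2 (add_left_cancel h1)
    rw [← mul_sub, ← map_sub] at h6
    have h5 := dual_ext2 h6
    exact (sub_eq_zero.1 h5).symm
  · have h1 := taylor q (fun i => algebraMap k (DualNumber k) (a i * y + b i * z))
      (fun i => algebraMap k (DualNumber k) (b i)) DualNumber.eps eps2
    have h2 := ev (Algebra.ofId k (DualNumber k)) hq a b (algebraMap k _ y)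
      (algebraMap k _ z + DualNumber.eps)
    simp only [Algebra.ofId_apply] at h2
    have h3 : (fun i => algebraMap k (DualNumber k) (a i * y + b i * z)
        + DualNumber.eps * algebraMap k (DualNumber k) (b i))
        = fun i => algebraMap k (DualNumber k) (a i) * (algebraMap k _ y)
          + algebraMap k (DualNumber k) (b i) * (algebraMap k _ z + DualNumber.eps) := by
      ext1 i; simp only [map_add, map_mul]; ring
    rw [h3, h2] at h1
    simp only [am, h0, ← map_mul, ← map_sum] at h1
    have h4 : qf (fun i => algebraMap k (DualNumber k) (cf q a b i))
        (algebraMap k _ y) (algebraMap k _ z + DualNumber.eps)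
        = algebraMap k _ (qf (cf q a b) y z) + DualNumber.eps * algebraMap k _ (
          cf q a b 1 * y ^ 3 + 2 * cf q a b 2 * y ^ 2 * z + 3 * cf q a b 3 * y * z ^ 2
        + 4 * cf q a b 4 * z ^ 3) := by
      have := eps2 (k := k)
      have h3' : (DualNumber.eps : DualNumber k) ^ 2 = 0 := by rw [pow_two, this]
      have h3'' : (DualNumber.eps : DualNumber k) ^ 3 = 0 := by rw [pow_succ, h3', zero_mul]
      have h34 : (DualNumber.eps : DualNumber k) ^ 4 = 0 := by rw [pow_succ, h3'', zero_mul]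
      simp only [qf, map_add, map_mul, map_pow, map_ofNat]
      ring_nf
      simp only [h3', h3'', h34]
      ring
    rw [h4] at h1
    have h6 := sub_eq_zero.2 (add_left_cancel h1)
    rw [← mul_sub, ← map_sub] at h6
    have h5 := dual_ext2 h6
    exact (sub_eq_zero.1 h5).symm

lemma cramer0 {k : Type*} [Field k] (a b e n : Fin 3 → k) (hdet : dot3 (cr a b) e ≠ 0)
    (ha : ∑ j, a j * n j = 0) (hb : ∑ j, b j * n j = 0) (he : ∑ j, e j * n j = 0) : n = 0 := by
  simp only [Fin.sum_univ_three] at ha hb he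
  simp [dot3, cr] at hdet
  ext i
  apply (mul_eq_zero.1 (_ : _ * n i = 0)).resolve_left hdet
  fin_cases i <;> simp [-mul_eq_zero]
  · linear_combination (b 1 * e 2 - b 2 * e 1) * ha + (e 1 * a 2 - e 2 * a 1) * hb
      + (a 1 * b 2 - a 2 * b 1) * he
  · linear_combination (b 2 * e 0 - b 0 * e 2) * ha + (e 2 * a 0 - e 0 * a 2) * hb
      + (a 2 * b 0 - a 0 * b 2) * he
  · linear_combination (b 0 * e 1 - b 1 * e 0) * ha + (e 0 * a 1 - e 1 * a 0) * hb
      + (a 0 * b 1 - a 1 * b 0) * he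

lemma comb_ne {k : Type*} [Field k] (a b : Fin 3 → k) (hab : cr a b ≠ 0) (y z : k)
    (hyz : y ≠ 0 ∨ z ≠ 0) : (fun i => a i * y + b i * z) ≠ 0 := by
  intro h
  have h0 := congrFun h 0
  have h1 := congrFun h 1
  have h2 := congrFun h 2
  simp at h0 h1 h2
  apply hab
  rcases hyz with hy | hz
  · ext i
    apply (mul_eq_zero.1 (_ : y * _ = 0)).resolve_left hy
    fin_cases i <;> simp [cr, -mul_eq_zero]
    · linear_combination b 2 * h1 - b 1 * h2
    · linear_combination b 0 * h2 - b 2 * h0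
    · linear_combination b 1 * h0 - b 0 * h1
  · ext i
    apply (mul_eq_zero.1 (_ : z * _ = 0)).resolve_left hz
    fin_cases i <;> simp [cr, -mul_eq_zero]
    · linear_combination a 1 * h2 - a 2 * h1
    · linear_combination a 2 * h0 - a 0 * h2
    · linear_combination a 0 * h1 - a 1 * h0

lemma exists_compl {k : Type*} [Field k] (a b : Fin 3 → k) (hab : cr a b ≠ 0) :
    ∃ e : Fin 3 → k, dot3 (cr a b) e ≠ 0 := by
  obtain ⟨i, hi⟩ := Function.ne_iff.1 hab
  refine ⟨Pi.single i 1, ?_⟩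
  fin_cases i <;> simpa [dot3, Pi.single_apply] using hi

lemma local_main {k : Type u} [Field k] [IsAlgClosed k] (h6 : (6 : k) ≠ 0)
    (qC qD : MvPolynomial (Fin 3) k) (hC4 : qC.IsHomogeneous 4) (hD4 : qD.IsHomogeneous 4)
    (hDsm : ∀ pt : Fin 3 → k, pt ≠ 0 → eval pt qD = 0 → ∃ i, eval pt (pderiv i qD) ≠ 0)
    (HC KC HD KD : MvPolynomial (Fin 3) k)
    (hHC : X 0 ^ 4 * HC = SG qC) (hKC : X 0 ^ 6 * KC = TG qC)
    (hHD : X 0 ^ 4 * HD = SG qD) (hKD : X 0 ^ 6 * KD = TG qD)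
    (hH : HD ∈ Ideal.span ({HC, KC} : Set (MvPolynomial (Fin 3) k)))
    (hK : KD ∈ Ideal.span ({HC, KC} : Set (MvPolynomial (Fin 3) k)))
    (a b : Fin 3 → k) (hab : cr a b ≠ 0)
    (h0 : cf qC a b 0 = 0) (h1 : cf qC a b 1 = 0) (h2 : cf qC a b 2 = 0) (h3 : cf qC a b 3 = 0) :
    cf qD a b 0 = 0 ∧ cf qD a b 1 = 0 ∧ cf qD a b 2 = 0 ∧ cf qD a b 3 = 0 ∧ cf qD a b 4 ≠ 0 := by
  obtain ⟨e, he⟩ := exists_compl a b hab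
  obtain ⟨c0, c1, c2, c3, -, hcf⟩ := cf_dual hC4 a b e
  obtain ⟨g0, g1, g2, g3, hg, hdf⟩ := cf_dual hD4 a b e
  -- the family of lines
  set a' : Fin 3 → Polynomial k :=
    fun i => algebraMap k _ (a i) + Polynomial.X ^ 2 * algebraMap k _ (e i) with ha'
  set b' : Fin 3 → Polynomial k :=
    fun i => algebraMap k _ (b i) + Polynomial.X * algebraMap k _ (e i) with hb'
  have hcr : cr a' b' 0 ≠ 0 := by
    have hexp : cr a' b' 0 = Polynomial.C (cr a b 0) + Polynomial.C (cr a e 0) * Polynomial.X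
        + Polynomial.C (cr e b 0) * Polynomial.X ^ 2 := by
      simp [cr, ha', hb']; ring
    intro hz
    rw [hexp] at hz
    have z0 := congrArg (fun p => Polynomial.coeff p 0) hz
    have z1 := congrArg (fun p => Polynomial.coeff p 1) hz
    have z2 := congrArg (fun p => Polynomial.coeff p 2) hz
    simp [Polynomial.coeff_X, Polynomial.coeff_X_pow, Polynomial.coeff_C] at z0 z1 z2
    simp [cr] at z0 z1 z2
    apply he
    simp [dot3, cr]
    linear_combination e 0 * z0 - b 0 * z1 - a 0 * z2
  have hS : ∃ u v, Sinv (cf qD a' b') = u * Sinv (cf qC a' b') + v * Tinv (cf qC a' b') := by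
    obtain ⟨u, v, huv⟩ := Ideal.mem_span_pair.1 hH
    refine ⟨aeval (cr a' b') u, aeval (cr a' b') v, ?_⟩
    rw [S_cross hD4 hHD a' b' hcr, S_cross hC4 hHC a' b' hcr, T_cross hC4 hKC a' b' hcr, ← huv]
    simp
  have hT : ∃ u v, Tinv (cf qD a' b') = u * Sinv (cf qC a' b') + v * Tinv (cf qC a' b') := by
    obtain ⟨u, v, huv⟩ := Ideal.mem_span_pair.1 hK
    refine ⟨aeval (cr a' b') u, aeval (cr a' b') v, ?_⟩
    rw [T_cross hD4 hKD a' b' hcr, S_cross hC4 hHC a' b' hcr, T_cross hC4 hKC a' b' hcr, ← huv]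
    simp
  -- pass to dual numbers
  set φ : Polynomial k →ₐ[k] DualNumber k := Polynomial.aeval DualNumber.eps with hφ
  have e2 := eps2 (k := k)
  have fa : (fun i => φ (a' i)) = fun i => algebraMap k (DualNumber k) (a i) := by
    ext1 i
    simp only [ha', hφ, map_add, map_mul, map_pow, Polynomial.aeval_X, AlgHom.commutes]
    rw [pow_two, e2]; simp
  have fb : (fun i => φ (b' i)) = fun i => algebraMap k (DualNumber k) (b i)
      + DualNumber.eps * algebraMap k (DualNumber k) (e i) := by
    ext1 i
    simp only [hb', hφ, map_add, map_mul, map_pow, Polynomial.aeval_X, AlgHom.commutes]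
  have cC := cf_map φ hC4 a' b'
  have cD := cf_map φ hD4 a' b'
  rw [fa, fb, hcf _ _ e2] at cC
  rw [fa, fb, hdf _ _ e2] at cD
  have SC : φ (Sinv (cf qC a' b')) = 0 := by
    have := Sinv_map (φ : Polynomial k →+* DualNumber k) (cf qC a' b')
    simp only [RingHom.coe_coe] at this
    rw [this, ← cC]
    simp [Sinv, h0, h1, h2, h3]
    linear_combination (-3 * algebraMap k (DualNumber k) c0 * algebraMap k _ c2 +
      algebraMap k (DualNumber k) c1 ^ 2) * e2
  have TC : φ (Tinv (cf qC a' b')) = 0 := by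
    have := Tinv_map (φ : Polynomial k →+* DualNumber k) (cf qC a' b')
    simp only [RingHom.coe_coe] at this
    rw [this, ← cC]
    simp [Tinv, h0, h1, h2, h3]
    linear_combination (-27 * algebraMap k (DualNumber k) c0 ^ 2 *
        (algebraMap k (DualNumber k) (cf qC a b 4) + DualNumber.eps * algebraMap k _ c3)
      + 9 * algebraMap k (DualNumber k) c0 * algebraMap k (DualNumber k) c1
        * algebraMap k (DualNumber k) c2 * DualNumber.eps
      - 2 * algebraMap k (DualNumber k) c1 ^ 3 * DualNumber.eps) * e2
  have SD : φ (Sinv (cf qD a' b')) = 0 := by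
    obtain ⟨u, v, h⟩ := hS
    rw [h]; simp [SC, TC]
  have TD : φ (Tinv (cf qD a' b')) = 0 := by
    obtain ⟨u, v, h⟩ := hT
    rw [h]; simp [SC, TC]
  have tS := Sinv_map (φ : Polynomial k →+* DualNumber k) (cf qD a' b')
  have tT := Tinv_map (φ : Polynomial k →+* DualNumber k) (cf qD a' b')
  simp only [RingHom.coe_coe] at tS tT
  rw [SD, ← cD] at tS
  rw [TD, ← cD] at tT
  set f := cf qD a b with hf
  have q2 : (DualNumber.eps : DualNumber k) ^ 2 = 0 := by rw [pow_two, e2]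
  have q3 : (DualNumber.eps : DualNumber k) ^ 3 = 0 := by rw [pow_succ, q2, zero_mul]
  have rS := dual_ext (k := k) (x := Sinv f)
    (y := 12 * f 0 * g3 - 3 * f 1 * g2 - 3 * f 3 * g0 + 2 * f 2 * g1) (by
      rw [tS]
      simp only [Sinv, map_add, map_sub, map_mul, map_pow, map_ofNat]
      simp
      ring_nf
      simp only [q2]
      ring)
  have rT := dual_ext (k := k) (x := Tinv f)
    (y := 72 * (f 0 * f 2 * g3 + f 0 * g1 * f 4) - 54 * f 0 * f 3 * g2
      - 27 * (2 * f 1 * g0 * f 4 + f 1 ^ 2 * g3)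
      + 9 * (g0 * f 2 * f 3 + f 1 * g1 * f 3 + f 1 * f 2 * g2) - 6 * f 2 ^ 2 * g1) (by
      rw [tT]
      simp only [Tinv, map_add, map_sub, map_mul, map_pow, map_ofNat]
      simp
      ring_nf
      simp only [q2, q3]
      ring)
  refine key h6 f g0 g1 g2 g3 rS.1 rT.1 rS.2 rT.2 ?_
  intro y z hyz hq0 hy hz hgz
  have hev := ev (AlgHom.id k k) hD4 a b y z
  simp [aeval_eq_eval] at hev
  obtain ⟨i, hi⟩ := hDsm (fun i => a i * y + b i * z) (comb_ne a b hab y z hyz) (by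
    rw [hev]; exact hq0)
  have hgr := grad hD4 a b y z
  have := cramer0 a b e (fun i => eval (fun i => a i * y + b i * z) (pderiv i qD)) he
    (by rw [hgr.1]; exact hy) (by rw [hgr.2]; exact hz) (by rw [hg]; exact hgz)
  exact hi (congrFun this i)

lemma cr_ne_of_li {k : Type*} [Field k] (a b : Fin 3 → k) (h : LinearIndependent k ![a, b]) :
    cr a b ≠ 0 := by
  intro h0
  rw [LinearIndependent.pair_iff] at h
  have c0 := congrFun h0 0
  have c1 := congrFun h0 1
  have c2 := congrFun h0 2
  simp [cr] at c0 c1 c2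
  have ha : ∀ i, a i = 0 := by
    intro i
    have := h (b i) (-a i) (by
      ext j
      simp
      fin_cases i <;> fin_cases j <;> simp <;> first | ring1 | linear_combination c0 | linear_combination c1 | linear_combination c2 | linear_combination -c0 | linear_combination -c1 | linear_combination -c2)
    exact neg_eq_zero.1 this.2
  have := h 1 0 (by ext j; simp [ha])
  exact one_ne_zero this.1

lemma hyper_basis {k : Type*} [Field k] {q : MvPolynomial (Fin 3) k} (hq : q.IsHomogeneous 4)
    {d p : Fin 3 → k} (h : IsHyperinflectionLineAt q d p) :
    d ≠ 0 ∧ ∃ a b : Fin 3 → k, cr a b ≠ 0 ∧ dot3 d a = 0 ∧ dot3 d b = 0 ∧ cf q a b 0 = 0 ∧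
      cf q a b 1 = 0 ∧ cf q a b 2 = 0 ∧ cf q a b 3 = 0 ∧ cf q a b 4 ≠ 0 := by
  obtain ⟨hd, a, b, s, t, hli, hda, hdb, hst, -, -, -, c, L, hc, hL, hL0, hres, hLst⟩ := h
  refine ⟨hd, ?_⟩
  have hab := cr_ne_of_li a b hli
  have hLe := bin_expand hL
  simp [Finset.sum_range_succ] at hLe
  set l0 := coeff (Finsupp.single 0 1) L with hl0
  set l1 := coeff (Finsupp.single 1 1) L with hl1
  have hz : l0 * s + l1 * t = 0 := by
    rw [hLe] at hLst
    simpa using hLst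
  have hf : cf q a b = tr ![0, 0, 0, 0, c] 0 0 l0 l1 := by
    apply cf_of_eq
    change restrictLine q a b = _
    rw [hres, tr_map, qf_tr, hLe]
    simp [qf]
  obtain ⟨m, n, hmn⟩ : ∃ m n : k, s * n - m * t ≠ 0 := by
    by_cases hs : s = 0
    · refine ⟨1, 0, ?_⟩
      intro h
      apply hst
      simp at h
      rw [hs, h]
    · exact ⟨0, 1, by simpa using hs⟩
  have hLmn : l0 * m + l1 * n ≠ 0 := by
    intro h
    have z0 : l0 = 0 := by
      apply (mul_eq_zero.1 (_ : _ * l0 = 0)).resolve_left hmn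
      linear_combination n * hz - t * h
    have z1 : l1 = 0 := by
      apply (mul_eq_zero.1 (_ : _ * l1 = 0)).resolve_left hmn
      linear_combination s * h - m * hz
    apply hL0
    rw [hLe, z0, z1]; simp
  have hcf := cf_tr hq a b s m t n
  have htt : tr (tr ![0, 0, 0, 0, c] 0 0 l0 l1) s m t n
      = tr ![0, 0, 0, 0, c] 0 0 (l0 * s + l1 * t) (l0 * m + l1 * n) := by
    ext i
    fin_cases i <;> simp [tr] <;> ring
  rw [hf, htt, hz] at hcf
  refine ⟨fun i => s * a i + t * b i, fun i => m * a i + n * b i, ?_, ?_, ?_, ?_⟩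
  · intro h
    apply hab
    ext i
    refine (mul_eq_zero.1 (?_ : (s * n - m * t) * cr a b i = 0)).resolve_left hmn
    have := congrFun h i
    fin_cases i <;> simp [cr, -mul_eq_zero] at this ⊢ <;> linear_combination this
  · simp only [dot3] at *; linear_combination s * hda + t * hdb
  · simp only [dot3] at *; linear_combination m * hda + n * hdb
  · rw [hcf]
    simp [tr, hc, hLmn]

lemma dot3_sum {k : Type*} [Field k] (d a : Fin 3 → k) : ∑ j, a j * d j = dot3 d a := by
  simp [Fin.sum_univ_three, dot3]; ring

lemma plane_span {k : Type*} [Field k] (a b d P : Fin 3 → k) (hab : cr a b ≠ 0) (hd : d ≠ 0)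
    (ha : dot3 d a = 0) (hb : dot3 d b = 0) (hP : dot3 d P = 0) :
    ∃ y z : k, P = fun i => a i * y + b i * z := by
  have hdet : dot3 (cr a b) P = 0 := by
    by_contra h
    exact hd (cramer0 a b P d h (by rw [dot3_sum, ha]) (by rw [dot3_sum, hb])
      (by rw [dot3_sum, hP]))
  simp [dot3, cr] at hdet
  obtain ⟨i, hi⟩ := Function.ne_iff.1 hab
  fin_cases i <;> simp [cr] at hi
  · have hD : (a 1 * b 2 - a 2 * b 1) * (a 1 * b 2 - a 2 * b 1)⁻¹ = 1 := mul_inv_cancel₀ hi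
    refine ⟨(P 1 * b 2 - P 2 * b 1) * (a 1 * b 2 - a 2 * b 1)⁻¹,
      (a 1 * P 2 - a 2 * P 1) * (a 1 * b 2 - a 2 * b 1)⁻¹, ?_⟩
    generalize (a 1 * b 2 - a 2 * b 1)⁻¹ = e at hD
    ext j
    fin_cases j <;> simp
    · linear_combination e * hdet -P 0 * hD
    · linear_combination -P 1 * hD
    · linear_combination -P 2 * hD
  · have hD : (a 2 * b 0 - a 0 * b 2) * (a 2 * b 0 - a 0 * b 2)⁻¹ = 1 := mul_inv_cancel₀ hi
    refine ⟨(P 2 * b 0 - P 0 * b 2) * (a 2 * b 0 - a 0 * b 2)⁻¹,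
      (a 2 * P 0 - a 0 * P 2) * (a 2 * b 0 - a 0 * b 2)⁻¹, ?_⟩
    generalize (a 2 * b 0 - a 0 * b 2)⁻¹ = e at hD
    ext j
    fin_cases j <;> simp
    · linear_combination -P 0 * hD
    · linear_combination e * hdet -P 1 * hD
    · linear_combination -P 2 * hD
  · have hD : (a 0 * b 1 - a 1 * b 0) * (a 0 * b 1 - a 1 * b 0)⁻¹ = 1 := mul_inv_cancel₀ hi
    refine ⟨(P 0 * b 1 - P 1 * b 0) * (a 0 * b 1 - a 1 * b 0)⁻¹,
      (a 0 * P 1 - a 1 * P 0) * (a 0 * b 1 - a 1 * b 0)⁻¹, ?_⟩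
    generalize (a 0 * b 1 - a 1 * b 0)⁻¹ = e at hD
    ext j
    fin_cases j <;> simp
    · linear_combination -P 0 * hD
    · linear_combination -P 1 * hD
    · linear_combination e * hdet -P 2 * hD

lemma par {k : Type*} [Field k] (a b d n : Fin 3 → k) (hab : cr a b ≠ 0) (hd : d ≠ 0)
    (ha : dot3 d a = 0) (hb : dot3 d b = 0) (hna : dot3 n a = 0) (hnb : dot3 n b = 0) :
    ∃ μ : k, n = μ • d := by
  obtain ⟨e, he⟩ := exists_compl a b hab
  have hde : dot3 d e ≠ 0 := by
    intro h
    exact hd (cramer0 a b e d he (by rw [dot3_sum, ha]) (by rw [dot3_sum, hb])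
      (by rw [dot3_sum, h]))
  have := cramer0 a b e (fun i => dot3 d e * n i - dot3 n e * d i) he
    (by rw [dot3_sum]; simp only [dot3] at *
        linear_combination (d 0 * e 0 + d 1 * e 1 + d 2 * e 2) * hna
          - (n 0 * e 0 + n 1 * e 1 + n 2 * e 2) * ha)
    (by rw [dot3_sum]; simp only [dot3] at *
        linear_combination (d 0 * e 0 + d 1 * e 1 + d 2 * e 2) * hnb
          - (n 0 * e 0 + n 1 * e 1 + n 2 * e 2) * hb)
    (by rw [dot3_sum]; simp only [dot3]; ring)
  refine ⟨dot3 n e / dot3 d e, ?_⟩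
  ext i
  have hi := congrFun this i
  simp at hi ⊢
  field_simp
  linear_combination hi

lemma cr_ne_of_nonprop {k : Type*} [Field k] (d d' : Fin 3 → k) (hd' : d' ≠ 0)
    (h : ¬ ∃ c : k, d = c • d') : cr d d' ≠ 0 := by
  intro h0
  apply h
  have c0 := congrFun h0 0
  have c1 := congrFun h0 1
  have c2 := congrFun h0 2
  simp [cr] at c0 c1 c2
  obtain ⟨m, hm⟩ := Function.ne_iff.1 hd'
  refine ⟨d m / d' m, ?_⟩
  ext j
  simp at hm ⊢
  fin_cases m <;> simp at hm ⊢ <;> fin_cases j <;> simp <;> field_simp <;>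
    first | linear_combination c0 | linear_combination c1 | linear_combination c2 | linear_combination -c0 | linear_combination -c1 | linear_combination -c2

lemma ev_id {k : Type*} [Field k] {q : MvPolynomial (Fin 3) k} (hq : q.IsHomogeneous 4)
    (a b : Fin 3 → k) (y z : k) :
    eval (fun i => a i * y + b i * z) q = qf (cf q a b) y z := by
  have hev := ev (AlgHom.id k k) hq a b y z
  simpa [aeval_eq_eval] using hev

/-- linear form -/
def lin {k : Type*} [Field k] (v : Fin 3 → k) : MvPolynomial (Fin 3) k :=
  ∑ m, C (v m) * X m

lemma eval_lin {k : Type*} [Field k] (v x : Fin 3 → k) : eval x (lin v) = dot3 v x := by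
  simp [lin, dot3, Fin.sum_univ_three]

lemma lin_ne {k : Type*} [Field k] (v : Fin 3 → k) (hv : v ≠ 0) : lin v ≠ 0 := by
  intro h
  obtain ⟨i, hi⟩ := Function.ne_iff.1 hv
  apply hi
  have := congrArg (eval (Pi.single i 1)) h
  rw [eval_lin] at this
  fin_cases i <;> simpa [dot3, Pi.single_apply] using this

lemma five_lines {k : Type*} [Field k] [Infinite k] (R : MvPolynomial (Fin 3) k)
    (hR : R.IsHomogeneous 4) (d : Fin 5 → Fin 3 → k) (hd0 : ∀ i, d i ≠ 0)
    (hddist : ∀ i j, i ≠ j → ¬ ∃ c : k, d i = c • d j)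
    (hv : ∀ i P, dot3 (d i) P = 0 → eval P R = 0) : R = 0 := by
  apply MvPolynomial.funext
  intro P
  rw [map_zero]
  by_cases hP : ∃ i, dot3 (d i) P = 0
  · obtain ⟨i, hi⟩ := hP
    exact hv i P hi
  push Not at hP
  set w : Fin 5 × Fin 5 → Fin 3 → k :=
    fun p m => dot3 (d p.1) P * d p.2 m - dot3 (d p.2) P * d p.1 m with hw
  have hwne : ∀ p : Fin 5 × Fin 5, p.1 ≠ p.2 → w p ≠ 0 := by
    intro p hp h
    apply hddist p.1 p.2 hp
    refine ⟨dot3 (d p.1) P / dot3 (d p.2) P, ?_⟩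
    ext m
    have := congrFun h m
    have h2 := hP p.2
    simp [hw] at this ⊢
    field_simp
    linear_combination -this
  have hprod : (∏ i, lin (d i)) * ∏ p ∈ Finset.univ.filter (fun p : Fin 5 × Fin 5 => p.1 ≠ p.2),
      lin (w p) ≠ 0 := by
    apply mul_ne_zero
    · exact Finset.prod_ne_zero_iff.2 fun i _ => lin_ne _ (hd0 i)
    · exact Finset.prod_ne_zero_iff.2 fun p hp => lin_ne _ (hwne p (Finset.mem_filter.1 hp).2)
  obtain ⟨Q, hQ⟩ : ∃ Q, eval Q ((∏ i, lin (d i)) *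
      ∏ p ∈ Finset.univ.filter (fun p : Fin 5 × Fin 5 => p.1 ≠ p.2), lin (w p)) ≠ 0 := by
    by_contra hcon
    push Not at hcon
    exact hprod (MvPolynomial.funext (fun x => by rw [hcon x, map_zero]))
  rw [map_mul, map_prod, map_prod] at hQ
  have hQ1 : ∀ i, dot3 (d i) Q ≠ 0 := by
    intro i
    rw [← eval_lin]
    exact Finset.prod_ne_zero_iff.1 (left_ne_zero_of_mul hQ) i (Finset.mem_univ _)
  have hQ2 : ∀ i j, i ≠ j → dot3 (w (i, j)) Q ≠ 0 := by
    intro i j hij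
    rw [← eval_lin]
    exact Finset.prod_ne_zero_iff.1 (right_ne_zero_of_mul hQ) (i, j) (by simp [hij])
  set f := cf R P Q with hf
  set p : Polynomial k := Polynomial.C (f 0) + Polynomial.C (f 1) * Polynomial.X
    + Polynomial.C (f 2) * Polynomial.X ^ 2 + Polynomial.C (f 3) * Polynomial.X ^ 3
    + Polynomial.C (f 4) * Polynomial.X ^ 4 with hp
  have hdeg : p.natDegree ≤ 4 := by rw [hp]; compute_degree
  have hev : ∀ t, p.eval t = eval (fun i => P i * 1 + Q i * t) R := by
    intro t
    rw [ev_id hR, hp]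
    simp [qf, ← hf]
  have hp0 : p = 0 := by
    apply Polynomial.eq_zero_of_natDegree_lt_card_of_eval_eq_zero p
      (f := fun i : Fin 5 => - dot3 (d i) P / dot3 (d i) Q)
    · intro i j hij
      by_contra hne
      apply hQ2 i j hne
      have h1 := hQ1 i
      have h2 := hQ1 j
      simp only at hij
      field_simp at hij
      simp only [hw]
      simp only [dot3] at hij ⊢
      linear_combination -hij
    · intro i
      rw [hev]
      apply hv i
      have h1 := hQ1 i
      have : dot3 (d i) (fun m => P m * 1 + Q m * (- dot3 (d i) P / dot3 (d i) Q))
        = dot3 (d i) P + dot3 (d i) Q * (- dot3 (d i) P / dot3 (d i) Q) := by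
        generalize (- dot3 (d i) P / dot3 (d i) Q) = c
        simp only [dot3]; ring
      rw [this]
      field_simp
      ring
    · simp; omega
  have := hev 0
  rw [hp0] at this
  simpa using this.symm

/-- Over an algebraically closed field of characteristic coprime to `6`,
two smooth plane quartics with the same inflection scheme (equal ideals `(H, K)` in
`k[u,v,w]`), the first of which has at least `5` distinct hyperinflection lines, coincide. -/
theorem stmt18 {k : Type*} [Field k] [IsAlgClosed k] (h6 : (6 : k) ≠ 0)
    (qC qD : MvPolynomial (Fin 3) k)
    (hC0 : qC ≠ 0) (hC4 : qC.IsHomogeneous 4)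
    (hCsm : ∀ pt : Fin 3 → k, pt ≠ 0 → eval pt qC = 0 → ∃ i, eval pt (pderiv i qC) ≠ 0)
    (hD0 : qD ≠ 0) (hD4 : qD.IsHomogeneous 4)
    (hDsm : ∀ pt : Fin 3 → k, pt ≠ 0 → eval pt qD = 0 → ∃ i, eval pt (pderiv i qD) ≠ 0)
    (HC KC HD KD : MvPolynomial (Fin 3) k)
    (hHC : X 0 ^ 4 * HC = SG qC) (hKC : X 0 ^ 6 * KC = TG qC)
    (hHD : X 0 ^ 4 * HD = SG qD) (hKD : X 0 ^ 6 * KD = TG qD)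
    (hFl : Ideal.span ({HC, KC} : Set (MvPolynomial (Fin 3) k)) = Ideal.span {HD, KD})
    (d : Fin 5 → Fin 3 → k)
    (hddist : ∀ i j, i ≠ j → ¬ ∃ c : k, d i = c • d j)
    (hChyp : ∀ i, ∃ pt : Fin 3 → k, IsHyperinflectionLineAt qC (d i) pt) :
    ∃ c : k, c ≠ 0 ∧ qD = c • qC := by
  have hH : HD ∈ Ideal.span ({HC, KC} : Set (MvPolynomial (Fin 3) k)) := by
    rw [hFl]; exact Ideal.subset_span (by simp)
  have hK : KD ∈ Ideal.span ({HC, KC} : Set (MvPolynomial (Fin 3) k)) := by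
    rw [hFl]; exact Ideal.subset_span (by simp)
  have hb : ∀ i, d i ≠ 0 ∧ ∃ a b : Fin 3 → k, cr a b ≠ 0 ∧ dot3 (d i) a = 0 ∧
      dot3 (d i) b = 0 ∧ cf qC a b 0 = 0 ∧
      cf qC a b 1 = 0 ∧ cf qC a b 2 = 0 ∧ cf qC a b 3 = 0 ∧ cf qC a b 4 ≠ 0 := by
    intro i
    obtain ⟨pt, hpt⟩ := hChyp i
    exact hyper_basis hC4 hpt
  have hd0 := fun i => (hb i).1
  choose a b hab hda hdb c0 c1 c2 c3 c4 using fun i => (hb i).2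
  have hD := fun i => local_main h6 qC qD hC4 hD4 hDsm HC KC HD KD hHC hKC hHD hKD hH hK
    (a i) (b i) (hab i) (c0 i) (c1 i) (c2 i) (c3 i)
  set lam : Fin 5 → k := fun i => cf qD (a i) (b i) 4 / cf qC (a i) (b i) 4 with hlam
  have hline : ∀ i P, dot3 (d i) P = 0 → eval P qD = lam i * eval P qC := by
    intro i P hP
    obtain ⟨y, z, rfl⟩ := plane_span (a i) (b i) (d i) P (hab i) (hd0 i) (hda i) (hdb i) hP
    obtain ⟨e0, e1, e2, e3, -⟩ := hD i
    have h4 := c4 i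
    rw [ev_id hC4, ev_id hD4]
    simp only [qf, e0, e1, e2, e3, c0 i, c1 i, c2 i, c3 i, hlam]
    field_simp
    ring
  -- the tangent line at a point of `C` on a hyperinflection line
  have htan : ∀ i P, dot3 (d i) P = 0 → eval P qC = 0 →
      ∃ μ : k, (fun j => eval P (pderiv j qC)) = μ • d i := by
    intro i P hP h0
    obtain ⟨y, z, rfl⟩ := plane_span (a i) (b i) (d i) P (hab i) (hd0 i) (hda i) (hdb i) hP
    rw [ev_id hC4] at h0
    simp [qf, c0 i, c1 i, c2 i, c3 i, c4 i] at h0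
    subst h0
    obtain ⟨g1, g2⟩ := grad hC4 (a i) (b i) y 0
    refine par (a i) (b i) (d i) _ (hab i) (hd0 i) (hda i) (hdb i) ?_ ?_
    · rw [← dot3_sum, g1]; simp [c0 i]
    · rw [← dot3_sum, g2]; simp [c1 i]
  have hlameq : ∀ i j, i ≠ j → lam i = lam j := by
    intro i j hij
    set o := cr (d i) (d j) with ho
    have ho0 : o ≠ 0 := cr_ne_of_nonprop _ _ (hd0 j) (hddist i j hij)
    have h1 : dot3 (d i) o = 0 := by simp [dot3, ho, cr]; ring
    have h2 : dot3 (d j) o = 0 := by simp [dot3, ho, cr]; ring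
    have hq : eval o qC ≠ 0 := by
      intro h0
      obtain ⟨μ, hμ⟩ := htan i o h1 h0
      obtain ⟨ν, hν⟩ := htan j o h2 h0
      obtain ⟨m, hm⟩ := hCsm o ho0 h0
      have hμ0 : μ ≠ 0 := by
        rintro rfl
        apply hm
        have := congrFun hμ m
        simpa using this
      apply hddist i j hij
      refine ⟨μ⁻¹ * ν, ?_⟩
      rw [mul_smul, ← hν, hμ, smul_smul, inv_mul_cancel₀ hμ0, one_smul]
    have := hline i o h1
    rw [hline j o h2] at this
    exact (mul_right_cancel₀ hq this).symm
  have hlam0 : lam 0 ≠ 0 := div_ne_zero (hD 0).2.2.2.2 (c4 0)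
  refine ⟨lam 0, hlam0, ?_⟩
  have : Infinite k := IsAlgClosed.instInfinite
  have hR := five_lines (qD - C (lam 0) * qC) (hD4.sub (hC4.C_mul _)) d hd0 hddist (by
    intro i P hP
    have hl : lam i = lam 0 := by
      by_cases h : i = 0
      · rw [h]
      · exact hlameq i 0 h
    rw [map_sub, map_mul, eval_C, hline i P hP, hl, sub_self])
  rw [smul_eq_C_mul]
  exact sub_eq_zero.1 hR
end
end
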